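/- Let X be a real analytic vector field on a neighborhood U of 0 ∈ ℝ² with X(0) = 0 and DX(0) having eigenvalues ±i. Suppose there is a transverse segment Σ through the origin, a positive integer k, and a sequence of orbits γ_ν ⊆ U \ {0} converging to 0 in the Hausdorff topology such that each γ_ν meets Σ in at most k points. Then 0 is a center for X, and X admits a real analytic first integral in a neighborhood of 0. -/

import Mathlib

namespace PL

/-- formal first integral in polar coordinates -/
def Sol (a : ℕ → ℝ → ℂ) (g d : ℕ → ℝ → ℝ) : Prop :=
  (∀ n θ, HasDerivAt (g n) (d n θ) θ) ∧
  ∀ n θ, ∑ x ∈ Finset.HasAntidiagonal.antidiagonal n,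
    (d x.1 θ * (a x.2 θ).im + (x.1 : ℝ) * g x.1 θ * (a x.2 θ).re) = 0

theorem sum_antidiag_split (n : ℕ) (f : ℕ → ℕ → ℝ) :
    ∑ x ∈ Finset.HasAntidiagonal.antidiagonal n, f x.1 x.2 = f n 0 + ∑ j ∈ Finset.range n, f j (n - j) := by
  rw [Finset.Nat.sum_antidiagonal_eq_sum_range_succ f n, Finset.sum_range_succ, Nat.sub_self,
    add_comm]

theorem Sol.d_eq {a : ℕ → ℝ → ℂ} (ha0 : ∀ θ, a 0 θ = Complex.I) {g d : ℕ → ℝ → ℝ}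
    (h : Sol a g d) (n : ℕ) (θ : ℝ) :
    d n θ = - ∑ j ∈ Finset.range n,
      (d j θ * (a (n - j) θ).im + (j : ℝ) * g j θ * (a (n - j) θ).re) := by
  have := h.2 n θ
  rw [sum_antidiag_split n
    (fun j m => d j θ * (a m θ).im + (j : ℝ) * g j θ * (a m θ).re)] at this
  simp only [ha0, Complex.I_im, Complex.I_re, mul_one, mul_zero, add_zero] at this
  linarith

theorem Sol.uniq {a : ℕ → ℝ → ℂ} (ha0 : ∀ θ, a 0 θ = Complex.I) {g d g2 d2 : ℕ → ℝ → ℝ}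
    (h : Sol a g d) (h2 : Sol a g2 d2) (hi : ∀ n, g n 0 = g2 n 0) (n : ℕ) :
    (∀ θ, g n θ = g2 n θ) ∧ (∀ θ, d n θ = d2 n θ) := by
  induction n using Nat.strong_induction_on with
  | _ n ih =>
    have hd : ∀ θ, d n θ = d2 n θ := by
      intro θ
      rw [h.d_eq ha0, h2.d_eq ha0]
      congr 1
      refine Finset.sum_congr rfl fun j hj => ?_
      have := ih j (Finset.mem_range.1 hj)
      rw [this.1, this.2]
    refine ⟨fun θ => ?_, hd⟩
    have hc : ∀ x, HasDerivAt (fun x => g n x - g2 n x) 0 x := by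
      intro x
      have := (h.1 n x).sub (h2.1 n x)
      rw [hd, sub_self] at this
      exact this
    have := is_const_of_deriv_eq_zero (fun x => (hc x).differentiableAt) (fun x => (hc x).deriv) θ 0
    simp only [hi] at this
    linarith

theorem Sol.shift {a : ℕ → ℝ → ℂ} {g d : ℕ → ℝ → ℝ}
    (h : Sol a g d) (s σ : ℝ) (hσ : ∀ m θ, a m (θ + s) = (σ : ℂ) ^ m * a m θ) (hσ2 : σ * σ = 1) :
    Sol a (fun n θ => σ ^ n * g n (θ + s)) (fun n θ => σ ^ n * d n (θ + s)) := by
  refine ⟨fun n θ => ?_, fun n θ => ?_⟩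
  · exact ((h.1 n (θ + s)).comp_add_const θ s).const_mul _
  · have := h.2 n (θ + s)
    rw [← mul_zero (σ ^ n), ← this, Finset.mul_sum]
    refine Finset.sum_congr rfl fun x hx => ?_
    have hx := Finset.HasAntidiagonal.mem_antidiagonal.1 hx
    rw [hσ, ← Complex.ofReal_pow, Complex.re_ofReal_mul, Complex.im_ofReal_mul, ← hx, pow_add]
    have : σ ^ x.2 * σ ^ x.2 = 1 := by rw [← mul_pow, hσ2, one_pow]
    linear_combination (-(σ ^ x.1 * d x.1 (θ + s) * (a x.2 θ).im +
      σ ^ x.1 * (x.1 : ℝ) * g x.1 (θ + s) * (a x.2 θ).re)) * this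

theorem Sol.prod {a : ℕ → ℝ → ℂ} {g d g2 d2 : ℕ → ℝ → ℝ}
    (h : Sol a g d) (h2 : Sol a g2 d2) :
    Sol a (fun n θ => ∑ x ∈ Finset.HasAntidiagonal.antidiagonal n, g x.1 θ * g2 x.2 θ)
      (fun n θ => ∑ x ∈ Finset.HasAntidiagonal.antidiagonal n, (d x.1 θ * g2 x.2 θ + g x.1 θ * d2 x.2 θ)) := by
  refine ⟨fun n θ => ?_, fun n θ => ?_⟩
  · exact HasDerivAt.fun_sum fun x _ => (h.1 x.1 θ).mul (h2.1 x.2 θ)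
  · let P : (ℕ → ℝ → ℝ) → PowerSeries ℝ := fun u => PowerSeries.mk fun n => u n θ
    let E : PowerSeries ℝ → PowerSeries ℝ := fun u => PowerSeries.mk fun n => n * PowerSeries.coeff n u
    have hE : ∀ u v, E (u * v) = E u * v + u * E v := by
      intro u v
      ext n
      simp only [E, PowerSeries.coeff_mk, PowerSeries.coeff_mul, map_add, Finset.mul_sum,
        ← Finset.sum_add_distrib]
      refine Finset.sum_congr rfl fun x hx => ?_
      rw [← Finset.HasAntidiagonal.mem_antidiagonal.1 hx]
      push_cast; ring
    let α := P fun n θ => (a n θ).im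
    let β := P fun n θ => (a n θ).re
    have e1 : P d * α + E (P g) * β = 0 := by
      ext n
      simpa [P, E, α, β, PowerSeries.coeff_mul, Finset.sum_add_distrib] using h.2 n θ
    have e2 : P d2 * α + E (P g2) * β = 0 := by
      ext n
      simpa [P, E, α, β, PowerSeries.coeff_mul, Finset.sum_add_distrib] using h2.2 n θ
    have e3 : (P d * P g2 + P g * P d2) * α + E (P g * P g2) * β = 0 := by
      rw [hE]; linear_combination (P g2) * e1 + (P g) * e2
    have := congrArg (PowerSeries.coeff n) e3
    simpa [P, E, α, β, PowerSeries.coeff_mul, Finset.sum_add_distrib] using this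

/-- the derivative recursion -/
noncomputable def dd (a : ℕ → ℝ → ℂ) (n : ℕ) : ℝ → ℝ := fun θ =>
  - ∑ j : Fin n, (dd a j θ * (a (n - j) θ).im + ((j : ℕ) : ℝ) *
      ((if (j : ℕ) = 1 then 1 else 0) + ∫ s in (0 : ℝ)..θ, dd a j s) * (a (n - j) θ).re)
termination_by n
decreasing_by all_goals exact j.2

noncomputable def gg (a : ℕ → ℝ → ℂ) (n : ℕ) : ℝ → ℝ := fun θ =>
  (if n = 1 then 1 else 0) + ∫ s in (0 : ℝ)..θ, dd a n s

theorem dd_eq (a : ℕ → ℝ → ℂ) (n : ℕ) (θ : ℝ) : dd a n θ = - ∑ j ∈ Finset.range n,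
      (dd a j θ * (a (n - j) θ).im + (j : ℝ) * gg a j θ * (a (n - j) θ).re) := by
  rw [dd, Finset.sum_range]
  rfl

theorem dd_cont (a : ℕ → ℝ → ℂ) (ha : ∀ m, Continuous (a m)) (n : ℕ) :
    Continuous (dd a n) ∧ Continuous (gg a n) := by
  induction n using Nat.strong_induction_on with
  | _ n ih =>
    have h1 : Continuous (dd a n) := by
      have : dd a n = fun θ => - ∑ j ∈ Finset.range n,
        (dd a j θ * (a (n - j) θ).im + (j : ℝ) * gg a j θ * (a (n - j) θ).re) := by
        funext θ; exact dd_eq a n θ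
      rw [this]
      refine Continuous.neg (continuous_finsetSum _ fun j hj => ?_)
      have h1 := (ih j (Finset.mem_range.1 hj)).1
      have h2 := (ih j (Finset.mem_range.1 hj)).2
      have h3 := ha (n - j)
      exact (h1.mul (Complex.continuous_im.comp h3)).add
        ((continuous_const.mul h2).mul (Complex.continuous_re.comp h3))
    refine ⟨h1, ?_⟩
    exact continuous_const.add (intervalIntegral.continuous_primitive (fun a b => h1.intervalIntegrable a b) 0)

theorem gg_sol (a : ℕ → ℝ → ℂ) (ha : ∀ m, Continuous (a m)) (ha0 : ∀ θ, a 0 θ = Complex.I) :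
    Sol a (gg a) (dd a) := by
  refine ⟨fun n θ => ?_, fun n θ => ?_⟩
  · have h1 := (dd_cont a ha n).1
    exact ((h1.integral_hasStrictDerivAt 0 θ).hasDerivAt).const_add _
  · rw [sum_antidiag_split n
      (fun j m => dd a j θ * (a m θ).im + (j : ℝ) * gg a j θ * (a m θ).re), dd_eq]
    simp [ha0]

theorem gg_zero (a : ℕ → ℝ → ℂ) (n : ℕ) : gg a n 0 = if n = 1 then 1 else 0 := by
  simp [gg]

theorem geom_bound (C A : ℝ) (hC : 0 ≤ C) (hA : 0 ≤ A) (n : ℕ) :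
    ∑ j ∈ Finset.range n, 2 * C * A ^ (n - j) * (A * (1 + 2 * C)) ^ j ≤ (A * (1 + 2 * C)) ^ n := by
  induction n with
  | zero => simp
  | succ n ih =>
    rw [Finset.sum_range_succ]
    have : ∑ j ∈ Finset.range n, 2 * C * A ^ (n + 1 - j) * (A * (1 + 2 * C)) ^ j =
      A * ∑ j ∈ Finset.range n, 2 * C * A ^ (n - j) * (A * (1 + 2 * C)) ^ j := by
      rw [Finset.mul_sum]
      refine Finset.sum_congr rfl fun j hj => ?_
      have := Finset.mem_range.1 hj
      rw [show n + 1 - j = (n - j) + 1 by omega, pow_succ]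
      ring
    rw [this, show n + 1 - n = 1 by omega]
    have := mul_le_mul_of_nonneg_left ih hA
    rw [pow_succ (A * (1 + 2 * C)) n]
    linarith

theorem gg_bound (a : ℕ → ℝ → ℂ) (ha : ∀ m, Continuous (a m)) (C A : ℝ) (hC : 0 ≤ C) (hA : 1 ≤ A)
    (hb : ∀ m θ, ‖a m θ‖ ≤ C * A ^ m) (n : ℕ) :
    ∀ θ, |dd a n θ| ≤ n * (A * (1 + 2 * C)) ^ n * Real.exp (n * |θ|) ∧
      |gg a n θ| ≤ (A * (1 + 2 * C)) ^ n * Real.exp (n * |θ|) := by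
  induction n using Nat.strong_induction_on with
  | _ n ih =>
    have hK : 1 ≤ A * (1 + 2 * C) := by nlinarith
    set K := A * (1 + 2 * C) with hKdef
    have h1 : ∀ θ, |dd a n θ| ≤ n * K ^ n * Real.exp (n * |θ|) := by
      intro θ
      rw [dd_eq, abs_neg]
      refine (Finset.abs_sum_le_sum_abs _ _).trans ?_
      have : ∀ j ∈ Finset.range n, |dd a j θ * (a (n - j) θ).im + (j : ℝ) * gg a j θ * (a (n - j) θ).re|
          ≤ (2 * C * A ^ (n - j) * K ^ j) * (n * Real.exp (n * |θ|)) := by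
        intro j hj
        have hjn := Finset.mem_range.1 hj
        obtain ⟨i1, i2⟩ := ih j hjn θ
        have b1 : |(a (n - j) θ).im| ≤ C * A ^ (n - j) := (Complex.abs_im_le_norm _).trans (hb _ _)
        have b2 : |(a (n - j) θ).re| ≤ C * A ^ (n - j) := (Complex.abs_re_le_norm _).trans (hb _ _)
        have hjn' : (j : ℝ) ≤ n := by exact_mod_cast hjn.le
        have e1 : Real.exp (j * |θ|) ≤ Real.exp (n * |θ|) := by
          apply Real.exp_le_exp.2; gcongr
        have p0 : 0 ≤ C * A ^ (n - j) := by positivity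
        calc _ ≤ |dd a j θ * (a (n - j) θ).im| + |(j : ℝ) * gg a j θ * (a (n - j) θ).re| := abs_add_le _ _
          _ = |dd a j θ| * |(a (n - j) θ).im| + (j : ℝ) * |gg a j θ| * |(a (n - j) θ).re| := by
            rw [abs_mul, abs_mul, abs_mul, Nat.abs_cast]
          _ ≤ (j * K ^ j * Real.exp (j * |θ|)) * (C * A ^ (n - j)) +
              j * (K ^ j * Real.exp (j * |θ|)) * (C * A ^ (n - j)) := by
            gcongr
          _ = (2 * C * A ^ (n - j) * K ^ j) * (j * Real.exp (j * |θ|)) := by ring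
          _ ≤ _ := by gcongr
      refine (Finset.sum_le_sum this).trans ?_
      rw [← Finset.sum_mul]
      have := geom_bound C A hC (by linarith) n
      calc _ ≤ K ^ n * (n * Real.exp (n * |θ|)) := by gcongr
        _ = _ := by ring
    refine fun θ => ⟨h1 θ, ?_⟩
    have hint : |∫ s in (0 : ℝ)..θ, dd a n s| ≤ K ^ n * (Real.exp (n * |θ|) - 1) := by
      have key : ∀ s : ℝ, 0 ≤ s → (∫ x in (0 : ℝ)..s, (n : ℝ) * K ^ n * Real.exp (n * x)) =
          K ^ n * (Real.exp (n * s) - 1) := by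
        intro s _
        have : ∀ x ∈ Set.uIcc 0 s, HasDerivAt (fun x : ℝ => K ^ n * Real.exp (n * x))
            ((n : ℝ) * K ^ n * Real.exp (n * x)) x := by
          intro x _
          have := (((hasDerivAt_id' x).const_mul (n : ℝ)).exp).const_mul (K ^ n)
          exact this.congr_deriv (by ring)
        rw [intervalIntegral.integral_eq_sub_of_hasDerivAt this
          (Continuous.intervalIntegrable (by fun_prop) _ _)]
        simp; ring
      rcases le_total 0 θ with h0 | h0
      · rw [abs_of_nonneg h0, ← key θ h0]
        have := intervalIntegral.norm_integral_le_of_norm_le (f := dd a n)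
          (g := fun x => (n : ℝ) * K ^ n * Real.exp (n * x)) (μ := MeasureTheory.volume) h0
          (Filter.Eventually.of_forall fun t ht => by
            have := h1 t
            rw [abs_of_pos ht.1] at this
            exact this) (Continuous.intervalIntegrable (by fun_prop) _ _)
        exact this
      · rw [abs_of_nonpos h0, ← key (-θ) (by linarith), intervalIntegral.integral_symm, abs_neg]
        have e : ∫ x in θ..0, dd a n x = ∫ x in (0 : ℝ)..(-θ), dd a n (-x) := by
          rw [intervalIntegral.integral_comp_neg (fun x => dd a n x)]; simp
        rw [e]
        have := intervalIntegral.norm_integral_le_of_norm_le (f := fun x => dd a n (-x))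
          (g := fun x => (n : ℝ) * K ^ n * Real.exp (n * x)) (μ := MeasureTheory.volume)
          (show (0 : ℝ) ≤ -θ by linarith)
          (Filter.Eventually.of_forall fun t ht => by
            have := h1 (-t)
            rw [abs_neg, abs_of_pos ht.1] at this
            exact this) (Continuous.intervalIntegrable (by fun_prop) _ _)
        exact this
    have h3 : |(if n = 1 then (1 : ℝ) else 0)| ≤ K ^ n := by
      have := one_le_pow₀ hK (n := n)
      split_ifs
      · simpa using this
      · simp; positivity
    calc |gg a n θ| ≤ _ := abs_add_le _ _
      _ ≤ K ^ n + K ^ n * (Real.exp (n * |θ|) - 1) := add_le_add h3 hint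
      _ = _ := by ring

end PL


namespace PL

noncomputable def Gam (g : ℕ → ℝ → ℝ) (r θ : ℝ) : ℝ := ∑' n, g n θ * r ^ n

theorem term_bound {B r x : ℝ} (hB : 0 < B) (hr : |r| ≤ 1 / (2 * B)) (n : ℕ) (hx : |x| ≤ B ^ n) :
    ‖x * r ^ n‖ ≤ (1 / 2) ^ n := by
  rw [norm_mul, norm_pow, Real.norm_eq_abs, Real.norm_eq_abs]
  calc |x| * |r| ^ n ≤ B ^ n * (1 / (2 * B)) ^ n := by gcongr
    _ = (1 / 2) ^ n := by rw [← mul_pow]; congr 1; field_simp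

theorem gam_summable {g : ℕ → ℝ → ℝ} {B r θ : ℝ} (hB : 0 < B) (hr : |r| ≤ 1 / (2 * B))
    (hg : ∀ n, |g n θ| ≤ B ^ n) : Summable fun n => ‖g n θ * r ^ n‖ :=
  Summable.of_nonneg_of_le (fun _ => norm_nonneg _) (fun n => term_bound hB hr n (hg n))
    summable_geometric_two

theorem gam_hasFDerivAt {a : ℕ → ℝ → ℂ} {g d : ℕ → ℝ → ℝ} (h : Sol a g d) {B L : ℝ} (hB : 0 < B)
    (hg : ∀ n θ, |θ| < L → |g n θ| ≤ B ^ n) (hd : ∀ n θ, |θ| < L → |d n θ| ≤ B ^ n)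
    {r θ : ℝ} (hr : |r| < 1 / (2 * B)) (hθ : |θ| < L) :
    ∃ D : ℝ × ℝ →L[ℝ] ℝ, HasFDerivAt (fun q : ℝ × ℝ => Gam g q.1 q.2) D (r, θ) ∧
      ∀ w : ℂ, HasSum (fun m => a m θ * (r : ℂ) ^ m) w → (Summable fun m => ‖a m θ * (r : ℂ) ^ m‖) →
        D (r * w.re, w.im) = 0 := by
  let f : ℕ → ℝ × ℝ → ℝ := fun n q => g n q.2 * q.1 ^ n
  let f' : ℕ → ℝ × ℝ → (ℝ × ℝ →L[ℝ] ℝ) := fun n q =>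
    (d n q.2 * q.1 ^ n) • ContinuousLinearMap.snd ℝ ℝ ℝ +
    (n * g n q.2 * q.1 ^ (n - 1)) • ContinuousLinearMap.fst ℝ ℝ ℝ
  let s : Set (ℝ × ℝ) := Metric.ball 0 (1 / (2 * B)) ×ˢ Metric.ball 0 L
  let u : ℕ → ℝ := fun n => (1 / 2) ^ n + 2 * B * (n * (1 / 2) ^ n)
  have hu : Summable u := by
    refine summable_geometric_two.add (Summable.mul_left _ ?_)
    have := summable_pow_mul_geometric_of_norm_lt_one 1 (r := (1 / 2 : ℝ)) (by norm_num)
    simpa using this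
  have hs : IsOpen s := Metric.isOpen_ball.prod Metric.isOpen_ball
  have hs' : IsPreconnected s :=
    ((convex_ball (0 : ℝ) (1 / (2 * B))).prod (convex_ball (0 : ℝ) L)).isPreconnected
  have hmem : ∀ q : ℝ × ℝ, q ∈ s ↔ |q.1| < 1 / (2 * B) ∧ |q.2| < L := by
    intro q; simp [s]
  have hf : ∀ n x, x ∈ s → HasFDerivAt (f n) (f' n x) x := by
    intro n q _
    have e1 := (h.1 n q.2).comp_hasFDerivAt q (hasFDerivAt_snd (𝕜 := ℝ) (E := ℝ) (F := ℝ) (p := q))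
    have e2 := (hasDerivAt_pow n q.1).comp_hasFDerivAt q (hasFDerivAt_fst (𝕜 := ℝ) (E := ℝ) (F := ℝ) (p := q))
    refine (e1.mul e2).congr_fderiv ?_
    ext <;> simp [f'] <;> ring
  have hf' : ∀ n x, x ∈ s → ‖f' n x‖ ≤ u n := by
    intro n q hq
    obtain ⟨q1, q2⟩ := (hmem q).1 hq
    refine (norm_add_le _ _).trans (add_le_add ?_ ?_)
    · rw [norm_smul]
      calc _ ≤ (1 / 2) ^ n * 1 := mul_le_mul (term_bound hB q1.le n (hd n _ q2))
            (ContinuousLinearMap.norm_snd_le ℝ ℝ ℝ) (norm_nonneg _) (by positivity)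
        _ = _ := mul_one _
    · rw [norm_smul]
      have : ‖(n : ℝ) * g n q.2 * q.1 ^ (n - 1)‖ ≤ 2 * B * (n * (1 / 2) ^ n) := by
        rcases n with _ | n
        · simp
        · rw [norm_mul, norm_mul, norm_pow, Real.norm_eq_abs, Real.norm_eq_abs, Real.norm_eq_abs,
            Nat.abs_cast, Nat.add_sub_cancel]
          have := hg (n + 1) _ q2
          calc _ ≤ ((n + 1 : ℕ) : ℝ) * B ^ (n + 1) * (1 / (2 * B)) ^ n := by gcongr
            _ = _ := by
              rw [div_pow, one_pow, mul_pow,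
                show (1 / 2 : ℝ) ^ (n + 1) = 1 / (2 ^ n * 2) by rw [div_pow, one_pow, pow_succ]]
              field_simp
              ring
      calc _ ≤ (2 * B * (n * (1 / 2) ^ n)) * 1 := mul_le_mul this
            (ContinuousLinearMap.norm_fst_le ℝ ℝ ℝ) (norm_nonneg _) (by positivity)
        _ = _ := mul_one _
  have hx : (r, θ) ∈ s := (hmem _).2 ⟨hr, hθ⟩
  have hgs := gam_summable hB hr.le (fun n => hg n θ hθ)
  have hds := gam_summable hB hr.le (fun n => hd n θ hθ)
  refine ⟨∑' n, f' n (r, θ), hasFDerivAt_tsum_of_isPreconnected hu hs hs' hf hf' hx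
    hgs.of_norm hx, ?_⟩
  intro w hw hws
  have hf's : Summable fun n => f' n (r, θ) := Summable.of_norm_bounded hu fun n => hf' n _ hx
  have happ : (∑' n, f' n (r, θ)) (r * w.re, w.im) = ∑' n, f' n (r, θ) (r * w.re, w.im) :=
    ContinuousLinearMap.map_tsum (ContinuousLinearMap.apply ℝ ℝ ((r * w.re, w.im) : ℝ × ℝ)) hf's
  rw [happ]
  have hngs : Summable fun n => ‖(n * g n θ) * r ^ n‖ := by
    have h0 := summable_pow_mul_geometric_of_norm_lt_one 1 (r := (1 / 2 : ℝ)) (by norm_num)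
    simp only [pow_one] at h0
    refine Summable.of_nonneg_of_le (fun _ => norm_nonneg _) (fun n => ?_) h0
    rw [mul_assoc, norm_mul, Real.norm_natCast]
    gcongr
    exact term_bound hB hr.le n (hg n θ hθ)
  have hcast : ∀ m, a m θ * (r : ℂ) ^ m = (r ^ m : ℝ) * a m θ := by
    intro m; push_cast; ring
  have hre : HasSum (fun m => (a m θ).re * r ^ m) w.re := by
    have := Complex.hasSum_re hw
    simp only [hcast, Complex.re_ofReal_mul] at this
    simpa only [mul_comm] using this
  have him : HasSum (fun m => (a m θ).im * r ^ m) w.im := by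
    have := Complex.hasSum_im hw
    simp only [hcast, Complex.im_ofReal_mul] at this
    simpa only [mul_comm] using this
  have hres : Summable fun m => ‖(a m θ).re * r ^ m‖ := by
    refine Summable.of_nonneg_of_le (fun _ => norm_nonneg _) (fun n => ?_) hws
    rw [norm_mul, norm_mul, norm_pow, norm_pow, Complex.norm_real]
    gcongr
    exact Complex.abs_re_le_norm _
  have hims : Summable fun m => ‖(a m θ).im * r ^ m‖ := by
    refine Summable.of_nonneg_of_le (fun _ => norm_nonneg _) (fun n => ?_) hws
    rw [norm_mul, norm_mul, norm_pow, norm_pow, Complex.norm_real]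
    gcongr
    exact Complex.abs_im_le_norm _
  have e0 : ∀ n, f' n (r, θ) (r * w.re, w.im) =
      (d n θ * r ^ n) * w.im + ((n * g n θ) * r ^ n) * w.re := by
    intro n
    rcases n with _ | n
    · simp [f']
    · simp [f']; ring
  simp only [e0]
  rw [(hds.of_norm.mul_right _).tsum_add (hngs.of_norm.mul_right _), tsum_mul_right, tsum_mul_right,
    ← hre.tsum_eq, ← him.tsum_eq,
    tsum_mul_tsum_eq_tsum_sum_antidiagonal_of_summable_norm hds hims,
    tsum_mul_tsum_eq_tsum_sum_antidiagonal_of_summable_norm hngs hres,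
    ← Summable.tsum_add (summable_norm_sum_mul_antidiagonal_of_summable_norm hds hims).of_norm
      (summable_norm_sum_mul_antidiagonal_of_summable_norm hngs hres).of_norm]
  rw [← tsum_zero (α := ℝ) (β := ℕ)]
  congr 1
  funext n
  rw [← Finset.sum_add_distrib, ← mul_zero (r ^ n), ← h.2 n θ, Finset.mul_sum]
  refine Finset.sum_congr rfl fun x hx => ?_
  rw [← Finset.HasAntidiagonal.mem_antidiagonal.1 hx, pow_add]
  ring

end PL


namespace PL

open Complex in
noncomputable def ee (x y : ℕ) : ℝ → ℂ := fun θ => exp (θ * I) ^ x * exp (-(θ * I)) ^ y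

def TP (n : ℕ) : Submodule ℂ (ℝ → ℂ) := Submodule.span ℂ {f | ∃ x y, x + y = n ∧ f = ee x y}

theorem ee_mem {x y n : ℕ} (h : x + y = n) : ee x y ∈ TP n :=
  Submodule.subset_span ⟨x, y, h, rfl⟩

theorem ee_mul (x y x' y' : ℕ) : ee x y * ee x' y' = ee (x + x') (y + y') := by
  funext θ; simp only [ee, Pi.mul_apply, pow_add]; ring

theorem TP_mul {m n : ℕ} {f g : ℝ → ℂ} (hf : f ∈ TP m) (hg : g ∈ TP n) : f * g ∈ TP (m + n) := by
  have h : TP m * TP n ≤ TP (m + n) := by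
    rw [TP, TP, Submodule.span_mul_span]
    refine Submodule.span_le.2 ?_
    rintro _ ⟨_, ⟨x, y, h, rfl⟩, _, ⟨x', y', h', rfl⟩, rfl⟩
    change ee x y * ee x' y' ∈ TP (m + n)
    rw [ee_mul]
    exact ee_mem (by omega)
  exact h (Submodule.mul_mem_mul hf hg)

theorem TP_sum {n : ℕ} {f : ℝ → ℂ} (hf : f ∈ TP n) : ∃ c : ℕ × ℕ → ℂ,
    f = fun θ => ∑ x ∈ Finset.HasAntidiagonal.antidiagonal n, c x * ee x.1 x.2 θ := by
  induction hf using Submodule.span_induction with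
  | mem f h =>
    obtain ⟨x, y, h, rfl⟩ := h
    refine ⟨fun z => if z = (x, y) then 1 else 0, ?_⟩
    funext θ
    simp [h]
  | zero => exact ⟨fun _ => 0, by funext; simp⟩
  | add f g _ _ hf hg =>
    obtain ⟨c, rfl⟩ := hf
    obtain ⟨c', rfl⟩ := hg
    refine ⟨fun x => c x + c' x, ?_⟩
    funext θ
    simp [add_mul, Finset.sum_add_distrib]
  | smul k f _ hf =>
    obtain ⟨c, rfl⟩ := hf
    refine ⟨fun x => k * c x, ?_⟩
    funext θ
    simp [Finset.mul_sum, mul_assoc]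

theorem sum_mem_TP (n : ℕ) (c : ℕ × ℕ → ℂ) :
    (fun θ => ∑ x ∈ Finset.HasAntidiagonal.antidiagonal n, c x * ee x.1 x.2 θ) ∈ TP n := by
  have : (fun θ => ∑ x ∈ Finset.HasAntidiagonal.antidiagonal n, c x * ee x.1 x.2 θ) =
    ∑ x ∈ Finset.HasAntidiagonal.antidiagonal n, c x • ee x.1 x.2 := by
    funext θ; simp
  rw [this]
  exact Submodule.sum_mem _ fun x hx => Submodule.smul_mem _ _
    (ee_mem (Finset.HasAntidiagonal.mem_antidiagonal.1 hx))

theorem conj_exp (θ : ℝ) : (starRingEnd ℂ) (Complex.exp (θ * Complex.I)) = Complex.exp (-(θ * Complex.I)) := by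
  rw [← Complex.exp_conj]; simp

theorem conj_exp' (θ : ℝ) : (starRingEnd ℂ) (Complex.exp (-(θ * Complex.I))) = Complex.exp ((θ * Complex.I)) := by
  rw [← Complex.exp_conj]; simp

theorem TP_conj {n : ℕ} {f : ℝ → ℂ} (hf : f ∈ TP n) : (fun θ => (starRingEnd ℂ) (f θ)) ∈ TP n := by
  induction hf using Submodule.span_induction with
  | mem f h =>
    obtain ⟨x, y, h, rfl⟩ := h
    have : (fun θ => (starRingEnd ℂ) (ee x y θ)) = ee y x := by
      funext θ
      simp only [ee, map_mul, map_pow, conj_exp, conj_exp']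
      ring
    rw [this]
    exact ee_mem (by omega)
  | zero =>
    simp only [Pi.zero_apply, map_zero]
    exact (TP n).zero_mem
  | add f g _ _ hf hg =>
    have := (TP n).add_mem hf hg
    convert this using 1
    funext θ; simp
  | smul k f _ hf =>
    have := (TP n).smul_mem ((starRingEnd ℂ) k) hf
    convert this using 1
    funext θ; simp

theorem TP_sign {n : ℕ} {f : ℝ → ℂ} (hf : f ∈ TP n) (θ : ℝ) :
    f (θ + Real.pi) = (-1) ^ n * f θ := by
  obtain ⟨c, rfl⟩ := TP_sum hf
  simp only [Finset.mul_sum]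
  refine Finset.sum_congr rfl fun x hx => ?_
  rw [← Finset.HasAntidiagonal.mem_antidiagonal.1 hx]
  have h1 : Complex.exp (((θ + Real.pi : ℝ) : ℂ) * Complex.I) = (-1) * Complex.exp (θ * Complex.I) := by
    push_cast
    rw [add_mul, Complex.exp_add, Complex.exp_pi_mul_I]; ring
  have h2 : Complex.exp (-(((θ + Real.pi : ℝ) : ℂ) * Complex.I)) = (-1) * Complex.exp (-(θ * Complex.I)) := by
    rw [Complex.exp_neg, h1, Complex.exp_neg, mul_inv]; norm_num
  simp only [ee, h1, h2, mul_pow, pow_add]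
  ring

theorem TP_cos : (fun θ : ℝ => ((Real.cos θ : ℝ) : ℂ)) ∈ TP 1 := by
  have : (fun θ : ℝ => ((Real.cos θ : ℝ) : ℂ)) = (1 / 2 : ℂ) • ee 1 0 + (1 / 2 : ℂ) • ee 0 1 := by
    funext θ
    simp only [ee, Complex.ofReal_cos, Complex.cos, Pi.add_apply, Pi.smul_apply, smul_eq_mul]
    simp only [pow_one, pow_zero, neg_mul]; ring
  rw [this]
  exact (TP 1).add_mem ((TP 1).smul_mem _ (ee_mem rfl)) ((TP 1).smul_mem _ (ee_mem rfl))

theorem TP_sin : (fun θ : ℝ => ((Real.sin θ : ℝ) : ℂ)) ∈ TP 1 := by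
  have : (fun θ : ℝ => ((Real.sin θ : ℝ) : ℂ)) =
      (-Complex.I / 2 : ℂ) • ee 1 0 + (Complex.I / 2 : ℂ) • ee 0 1 := by
    funext θ
    simp only [ee, Complex.ofReal_sin, Complex.sin, Pi.add_apply, Pi.smul_apply, smul_eq_mul]
    simp only [pow_one, pow_zero, neg_mul]; ring
  rw [this]
  exact (TP 1).add_mem ((TP 1).smul_mem _ (ee_mem rfl)) ((TP 1).smul_mem _ (ee_mem rfl))

theorem TP_multilinear (n : ℕ) : ∀ p : ContinuousMultilinearMap ℝ (fun _ : Fin n => ℂ) ℂ,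
    (fun θ : ℝ => p (fun _ => Complex.exp (θ * Complex.I))) ∈ TP n := by
  induction n with
  | zero =>
    intro p
    have : (fun θ : ℝ => p (fun _ => Complex.exp (θ * Complex.I))) = (p (fun _ => 0)) • ee 0 0 := by
      funext θ
      simp only [ee, Pi.smul_apply, pow_zero, smul_eq_mul, mul_one]
      congr 1
      exact Subsingleton.elim _ _
    rw [this]
    exact (TP 0).smul_mem _ (ee_mem rfl)
  | succ n ih =>
    intro p
    have : (fun θ : ℝ => p (fun _ => Complex.exp (θ * Complex.I))) =
        (fun θ : ℝ => ((Real.cos θ : ℝ) : ℂ)) *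
          (fun θ : ℝ => p.curryLeft 1 (fun _ => Complex.exp (θ * Complex.I))) +
        (fun θ : ℝ => ((Real.sin θ : ℝ) : ℂ)) *
          (fun θ : ℝ => p.curryLeft Complex.I (fun _ => Complex.exp (θ * Complex.I))) := by
      funext θ
      have h1 : p (fun _ => Complex.exp (θ * Complex.I)) =
        p.curryLeft (Complex.exp (θ * Complex.I)) (fun _ => Complex.exp (θ * Complex.I)) := by
        rw [ContinuousMultilinearMap.curryLeft_apply]
        congr 1
        funext i
        refine Fin.cases ?_ (fun i => ?_) i <;> simp
      have h2 : ∀ u : ℂ, p.curryLeft (Complex.exp (θ * Complex.I)) =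
        (Real.cos θ) • p.curryLeft 1 + (Real.sin θ) • p.curryLeft Complex.I := by
        intro u
        rw [← map_smul, ← map_smul, ← map_add]
        congr 1
        rw [Complex.exp_mul_I]
        simp
      rw [h1, h2 0]
      simp
    have hn : TP (n + 1) = TP (1 + n) := by rw [add_comm]
    rw [this, hn]
    exact (TP _).add_mem (TP_mul TP_cos (ih _)) (TP_mul TP_sin (ih _))

theorem ee_deriv (x y : ℕ) (θ : ℝ) :
    HasDerivAt (ee x y) (Complex.I * ((x : ℂ) - y) * ee x y θ) θ := by
  have h0 : HasDerivAt (fun θ : ℝ => (θ : ℂ) * Complex.I) (1 * Complex.I) θ :=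
    (Complex.ofRealCLM.hasDerivAt (x := θ)).mul_const _
  have h1 := (h0.cexp).pow x
  have h2 := (h0.neg.cexp).pow y
  refine (h1.mul h2).congr_deriv ?_
  simp only [ee, Pi.pow_apply, Pi.neg_apply]
  rcases x with _ | x <;> rcases y with _ | y <;>
    simp only [Nat.add_sub_cancel, pow_succ, pow_zero] <;> push_cast <;> ring

theorem ee_K1 {n : ℕ} {F A : ℝ → ℂ} (hF : F ∈ TP (n + 1))
    (hA : ∀ θ, A θ = F θ * Complex.exp (-(θ * Complex.I))) (x y : ℕ) :
    (fun θ => (x : ℂ) * ee x y θ * A θ) ∈ TP (x + y + n) := by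
  rcases x with _ | x
  · simp only [Nat.cast_zero, zero_mul]
    exact (TP _).zero_mem
  · have : (fun θ => ((x + 1 : ℕ) : ℂ) * ee (x + 1) y θ * A θ) =
      (((x + 1 : ℕ) : ℂ)) • (ee x y * F) := by
      funext θ
      have e : Complex.exp (θ * Complex.I) * Complex.exp (-(θ * Complex.I)) = 1 := by
        rw [← Complex.exp_add]; simp
      simp only [Pi.smul_apply, Pi.mul_apply, ee, hA, pow_succ, smul_eq_mul]
      linear_combination (((x + 1 : ℕ) : ℂ)) * Complex.exp (θ * Complex.I) ^ x *
        Complex.exp (-(θ * Complex.I)) ^ y * F θ * e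
    rw [this]
    have h := TP_mul (ee_mem (x := x) (y := y) rfl) hF
    rw [show x + 1 + y + n = x + y + (n + 1) by ring]
    exact (TP _).smul_mem _ h

theorem ee_K2 {n : ℕ} {F A : ℝ → ℂ} (hF : F ∈ TP (n + 1))
    (hA : ∀ θ, A θ = F θ * Complex.exp (-(θ * Complex.I))) (x y : ℕ) :
    (fun θ => (y : ℂ) * ee x y θ * (starRingEnd ℂ) (A θ)) ∈ TP (x + y + n) := by
  have h := TP_conj (ee_K1 hF hA y x)
  have : (fun θ => (starRingEnd ℂ) ((y : ℂ) * ee y x θ * A θ)) =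
      (fun θ => (y : ℂ) * ee x y θ * (starRingEnd ℂ) (A θ)) := by
    funext θ
    simp only [ee, map_mul, map_pow, conj_exp, conj_exp', map_natCast]
    ring
  rw [this, add_comm y x] at h
  exact h

theorem poly {a : ℕ → ℝ → ℂ} {F : ℕ → ℝ → ℂ} (hF : ∀ n, F n ∈ TP n)
    (hA : ∀ n θ, a n θ = F (n + 1) θ * Complex.exp (-(θ * Complex.I)))
    (ha0 : ∀ θ, a 0 θ = Complex.I) {h d : ℕ → ℝ → ℝ} (hs : Sol a h d)
    (hsign : ∀ n θ, h n (θ + Real.pi) = (-1) ^ n * h n θ) (n : ℕ) :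
    (fun θ => (h n θ : ℂ)) ∈ TP n := by
  induction n using Nat.strong_induction_on with
  | _ n ih =>
  have hQ : (fun θ => (d n θ : ℂ)) ∈ TP n := by
    have e : (fun θ => (d n θ : ℂ)) = - ∑ j ∈ Finset.range n,
      (fun θ => ((d j θ * (a (n - j) θ).im + (j : ℝ) * h j θ * (a (n - j) θ).re : ℝ) : ℂ)) := by
      funext θ
      rw [hs.d_eq ha0]
      simp
    rw [e]
    refine (TP n).neg_mem (Submodule.sum_mem _ fun j hj => ?_)
    have hj := Finset.mem_range.1 hj
    obtain ⟨c, hc⟩ := TP_sum (ih j hj)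
    have hd : ∀ θ, (d j θ : ℂ) = ∑ x ∈ Finset.HasAntidiagonal.antidiagonal j,
        c x * (Complex.I * ((x.1 : ℂ) - x.2) * ee x.1 x.2 θ) := by
      intro θ
      have h1 : HasDerivAt (fun θ => (h j θ : ℂ)) (d j θ : ℂ) θ := (hs.1 j θ).ofReal_comp
      rw [hc] at h1
      exact h1.unique (HasDerivAt.fun_sum fun x _ => (ee_deriv x.1 x.2 θ).const_mul _)
    have e2 : (fun θ => ((d j θ * (a (n - j) θ).im + (j : ℝ) * h j θ * (a (n - j) θ).re : ℝ) : ℂ)) =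
      ∑ x ∈ Finset.HasAntidiagonal.antidiagonal j, c x •
        ((fun θ => (x.1 : ℂ) * ee x.1 x.2 θ * a (n - j) θ) +
         (fun θ => (x.2 : ℂ) * ee x.1 x.2 θ * (starRingEnd ℂ) (a (n - j) θ))) := by
      funext θ
      have h1 := hd θ
      have h2 := congrFun hc θ
      push_cast
      rw [h1, h2]
      simp only [Finset.sum_apply, Pi.smul_apply, Pi.add_apply, Finset.sum_mul, Finset.mul_sum,
        smul_eq_mul, ← Finset.sum_add_distrib]
      refine Finset.sum_congr rfl fun x hx => ?_
      have hx := Finset.HasAntidiagonal.mem_antidiagonal.1 hx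
      have hx' : (j : ℂ) = x.1 + x.2 := by rw [← hx]; push_cast; rfl
      rw [hx']
      have h3 : (starRingEnd ℂ) (a (n - j) θ) = (a (n - j) θ).re - (a (n - j) θ).im * Complex.I := by
        apply Complex.ext <;> simp
      have h4 : a (n - j) θ = (a (n - j) θ).re + (a (n - j) θ).im * Complex.I := by
        apply Complex.ext <;> simp
      rw [h3]
      generalize (a (n - j) θ).re = α at *
      generalize (a (n - j) θ).im = β at *
      rw [h4]
      ring
    rw [e2]
    refine Submodule.sum_mem _ fun x hx => (TP n).smul_mem _ ?_
    have hx := Finset.HasAntidiagonal.mem_antidiagonal.1 hx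
    have k1 := ee_K1 (hF _) (hA (n - j)) x.1 x.2
    have k2 := ee_K2 (hF _) (hA (n - j)) x.1 x.2
    rw [show x.1 + x.2 + (n - j) = n by omega] at k1 k2
    exact (TP n).add_mem k1 k2
  obtain ⟨q, hq⟩ := TP_sum hQ
  let P : ℝ → ℂ := fun θ => ∑ x ∈ Finset.HasAntidiagonal.antidiagonal n,
    (if x.1 = x.2 then 0 else q x / (Complex.I * ((x.1 : ℂ) - x.2))) * ee x.1 x.2 θ
  have hP : P ∈ TP n := sum_mem_TP n _
  let κ : ℂ := ∑ x ∈ Finset.HasAntidiagonal.antidiagonal n, if x.1 = x.2 then q x else 0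
  have hder : ∀ θ, HasDerivAt (fun θ => (h n θ : ℂ) - P θ - κ * (θ : ℂ)) 0 θ := by
    intro θ
    have h1 : HasDerivAt (fun θ => (h n θ : ℂ)) (d n θ : ℂ) θ := (hs.1 n θ).ofReal_comp
    have h2 : HasDerivAt P (∑ x ∈ Finset.HasAntidiagonal.antidiagonal n,
      (if x.1 = x.2 then 0 else q x / (Complex.I * ((x.1 : ℂ) - x.2))) *
        (Complex.I * ((x.1 : ℂ) - x.2) * ee x.1 x.2 θ)) θ :=
      HasDerivAt.fun_sum fun x _ => (ee_deriv x.1 x.2 θ).const_mul _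
    have h3 : HasDerivAt (fun θ : ℝ => κ * (θ : ℂ)) (κ * 1) θ :=
      (Complex.ofRealCLM.hasDerivAt (x := θ)).const_mul _
    refine ((h1.sub h2).sub h3).congr_deriv ?_
    have := congrFun hq θ
    rw [this, ← Finset.sum_sub_distrib, mul_one, ← Finset.sum_sub_distrib]
    refine Finset.sum_eq_zero fun x _ => ?_
    split_ifs with hx
    · have : ee x.1 x.2 θ = 1 := by
        rw [hx, ee, ← mul_pow, ← Complex.exp_add]; simp
      rw [this]; ring
    · have : ((x.1 : ℂ) - x.2) ≠ 0 := by
        rw [sub_ne_zero]; exact_mod_cast hx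
      have hI := Complex.I_ne_zero
      field_simp
      ring
  obtain ⟨D, hD⟩ : ∃ D : ℂ, ∀ θ, (h n θ : ℂ) = P θ + κ * (θ : ℂ) + D := by
    refine ⟨(h n 0 : ℂ) - P 0 - κ * ((0 : ℝ) : ℂ), fun θ => ?_⟩
    have := is_const_of_deriv_eq_zero (fun x => (hder x).differentiableAt) (fun x => (hder x).deriv) θ 0
    linear_combination this
  have hrel : ∀ θ : ℝ, κ * ((θ : ℂ) + Real.pi) + D = (-1) ^ n * (κ * θ + D) := by
    intro θ
    have h1 := hD (θ + Real.pi)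
    rw [hsign, TP_sign hP] at h1
    push_cast at h1
    rw [hD θ] at h1
    linear_combination -h1
  have hpi : (Real.pi : ℂ) ≠ 0 := by exact_mod_cast Real.pi_ne_zero
  have r0 := hrel 0
  have r1 := hrel 1
  push_cast at r0 r1
  rcases Nat.even_or_odd n with hn | hn
  · rw [hn.neg_one_pow] at r0
    have hκ : κ = 0 := by
      have : κ * Real.pi = 0 := by linear_combination r0
      exact (mul_eq_zero.1 this).resolve_right hpi
    obtain ⟨m, hm⟩ := hn
    have : (fun θ => (h n θ : ℂ)) = P + D • ee m m := by
      funext θ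
      have e : ee m m θ = 1 := by
        rw [ee, ← mul_pow, ← Complex.exp_add]; simp
      rw [hD θ, hκ]
      simp [e]
    rw [this]
    exact (TP n).add_mem hP ((TP n).smul_mem _ (ee_mem hm.symm))
  · rw [hn.neg_one_pow] at r0 r1
    have hκ : κ = 0 := by linear_combination (r1 - r0) / 2
    have hD0 : D = 0 := by rw [hκ] at r0; linear_combination r0 / 2
    have : (fun θ => (h n θ : ℂ)) = P := by
      funext θ
      rw [hD θ, hκ, hD0]; simp
    rw [this]
    exact hP

end PL


namespace PL

theorem ee_cont (u v : ℕ) : Continuous (ee u v) := by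
  unfold ee; fun_prop

theorem ee_integral (u v : ℕ) :
    ∫ θ in (0 : ℝ)..(2 * Real.pi), ee u v θ = if u = v then 2 * (Real.pi : ℂ) else 0 := by
  split_ifs with h
  · have : ∀ θ, ee u v θ = 1 := by
      intro θ
      rw [h, ee, ← mul_pow, ← Complex.exp_add]; simp
    simp [this]
  · have hne : ((u : ℂ) - v) ≠ 0 := by
      rw [sub_ne_zero]; exact_mod_cast h
    have hk : Complex.I * ((u : ℂ) - v) ≠ 0 := mul_ne_zero Complex.I_ne_zero hne
    have hd : ∀ θ ∈ Set.uIcc 0 (2 * Real.pi),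
        HasDerivAt (fun θ => (Complex.I * ((u : ℂ) - v))⁻¹ * ee u v θ) (ee u v θ) θ := by
      intro θ _
      refine ((ee_deriv u v θ).const_mul _).congr_deriv ?_
      field_simp
    rw [intervalIntegral.integral_eq_sub_of_hasDerivAt hd ((ee_cont u v).intervalIntegrable _ _)]
    have h1 : Complex.exp (((2 * Real.pi : ℝ) : ℂ) * Complex.I) = 1 := by
      push_cast; exact Complex.exp_two_pi_mul_I
    have e1 : ee u v (2 * Real.pi) = 1 := by
      rw [ee, Complex.exp_neg, h1]; simp
    have e2 : ee u v 0 = 1 := by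
      rw [ee]; simp
    rw [e1, e2, sub_self]

theorem fourier_bound {n : ℕ} {c : ℕ × ℕ → ℂ} {M : ℝ}
    (hM : ∀ θ : ℝ, 0 ≤ θ → θ ≤ 2 * Real.pi →
      ‖∑ x ∈ Finset.HasAntidiagonal.antidiagonal n, c x * ee x.1 x.2 θ‖ ≤ M)
    (x : ℕ × ℕ) (hx : x.1 + x.2 = n) : ‖c x‖ ≤ M := by
  have hint : ∫ θ in (0 : ℝ)..(2 * Real.pi),
      (∑ y ∈ Finset.HasAntidiagonal.antidiagonal n, c y * ee y.1 y.2 θ) * ee x.2 x.1 θ =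
      2 * Real.pi * c x := by
    have : ∀ θ, (∑ y ∈ Finset.HasAntidiagonal.antidiagonal n, c y * ee y.1 y.2 θ) * ee x.2 x.1 θ =
      ∑ y ∈ Finset.HasAntidiagonal.antidiagonal n, c y * ee (y.1 + x.2) (y.2 + x.1) θ := by
      intro θ
      rw [Finset.sum_mul]
      refine Finset.sum_congr rfl fun y _ => ?_
      rw [← ee_mul, Pi.mul_apply]; ring
    simp only [this]
    rw [intervalIntegral.integral_finsetSum
      (fun y _ => ((ee_cont _ _).const_mul _).intervalIntegrable _ _)]
    simp only [intervalIntegral.integral_const_mul, ee_integral]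
    rw [Finset.sum_eq_single x]
    · rw [if_pos (by omega)]; ring
    · intro y hy hyx
      have hy := Finset.HasAntidiagonal.mem_antidiagonal.1 hy
      rw [if_neg, mul_zero]
      intro h
      exact hyx (Prod.ext (by omega) (by omega))
    · intro h
      exact absurd (Finset.HasAntidiagonal.mem_antidiagonal.2 hx) h
  have hee : ∀ θ, ‖ee x.2 x.1 θ‖ = 1 := by
    intro θ
    rw [ee, norm_mul, norm_pow, norm_pow, Complex.norm_exp_ofReal_mul_I,
      show -((θ : ℂ) * Complex.I) = ((-θ : ℝ) : ℂ) * Complex.I by push_cast; ring,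
      Complex.norm_exp_ofReal_mul_I]
    simp
  have hb := intervalIntegral.norm_integral_le_of_norm_le_const (a := (0 : ℝ)) (b := 2 * Real.pi)
    (C := M)
    (f := fun θ => (∑ y ∈ Finset.HasAntidiagonal.antidiagonal n, c y * ee y.1 y.2 θ) * ee x.2 x.1 θ)
    (by
      intro θ hθ
      rw [Set.uIoc_of_le (by positivity)] at hθ
      rw [norm_mul, hee, mul_one]
      exact hM θ hθ.1.le hθ.2)
  rw [hint, sub_zero, abs_of_pos Real.two_pi_pos] at hb
  have : ‖2 * (Real.pi : ℂ) * c x‖ = 2 * Real.pi * ‖c x‖ := by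
    rw [norm_mul, norm_mul, Complex.norm_real]
    simp [abs_of_pos Real.pi_pos]
  rw [this, mul_comm M] at hb
  exact le_of_mul_le_mul_left hb Real.two_pi_pos

noncomputable def FF (c : ℕ × ℕ → ℂ) (z : ℂ) : ℂ :=
  ∑' n, ∑ x ∈ Finset.HasAntidiagonal.antidiagonal n, c x * (z ^ x.1 * (starRingEnd ℂ) z ^ x.2)

noncomputable def pp (c : ℕ × ℕ → ℂ) : FormalMultilinearSeries ℝ ℂ ℂ := fun n =>
  ∑ x ∈ Finset.HasAntidiagonal.antidiagonal n, c x •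
    (ContinuousMultilinearMap.mkPiAlgebra ℝ (Fin n) ℂ).compContinuousLinearMap
      (fun i : Fin n => if (i : ℕ) < x.1 then ContinuousLinearMap.id ℝ ℂ
        else (Complex.conjCLE : ℂ →L[ℝ] ℂ))

theorem pp_apply (c : ℕ × ℕ → ℂ) (n : ℕ) (z : ℂ) : pp c n (fun _ => z) =
    ∑ x ∈ Finset.HasAntidiagonal.antidiagonal n, c x * (z ^ x.1 * (starRingEnd ℂ) z ^ x.2) := by
  rw [pp, sum_apply]
  refine Finset.sum_congr rfl fun x hx => ?_
  have hx := Finset.HasAntidiagonal.mem_antidiagonal.1 hx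
  rw [smul_apply, smul_eq_mul]
  congr 1
  rw [ContinuousMultilinearMap.compContinuousLinearMap_apply,
    ContinuousMultilinearMap.mkPiAlgebra_apply]
  have : ∀ i : Fin n, (if (i : ℕ) < x.1 then ContinuousLinearMap.id ℝ ℂ
        else (Complex.conjCLE : ℂ →L[ℝ] ℂ)) z = (fun i : ℕ => if i < x.1 then z else (starRingEnd ℂ) z) i := by
    intro i
    simp only
    split_ifs <;> simp
  simp only [this]
  rw [Fin.prod_univ_eq_prod_range (fun i : ℕ => if i < x.1 then z else (starRingEnd ℂ) z) n, ← hx,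
    Finset.prod_range_add]
  congr 1
  · rw [Finset.prod_congr rfl (g := fun _ => z), Finset.prod_const, Finset.card_range]
    intro i hi
    rw [if_pos (Finset.mem_range.1 hi)]
  · rw [Finset.prod_congr rfl (g := fun _ => (starRingEnd ℂ) z), Finset.prod_const, Finset.card_range]
    intro i hi
    rw [if_neg (by omega)]

theorem FF_analytic {c : ℕ × ℕ → ℂ} {B : ℝ} (hB : 0 < B) (hc : ∀ x, ‖c x‖ ≤ B ^ (x.1 + x.2)) :
    AnalyticAt ℝ (FF c) 0 := by
  have hn : ∀ n, ‖pp c n‖ ≤ (n + 1) * B ^ n := by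
    intro n
    refine (norm_sum_le _ _).trans ?_
    have : ∀ x ∈ Finset.HasAntidiagonal.antidiagonal n, ‖c x •
      (ContinuousMultilinearMap.mkPiAlgebra ℝ (Fin n) ℂ).compContinuousLinearMap
      (fun i : Fin n => if (i : ℕ) < x.1 then ContinuousLinearMap.id ℝ ℂ
        else (Complex.conjCLE : ℂ →L[ℝ] ℂ))‖ ≤ B ^ n := by
      intro x hx
      have hx := Finset.HasAntidiagonal.mem_antidiagonal.1 hx
      rw [norm_smul]
      have h1 : ‖(ContinuousMultilinearMap.mkPiAlgebra ℝ (Fin n) ℂ).compContinuousLinearMap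
        (fun i : Fin n => if (i : ℕ) < x.1 then ContinuousLinearMap.id ℝ ℂ
        else (Complex.conjCLE : ℂ →L[ℝ] ℂ))‖ ≤ 1 := by
        refine (ContinuousMultilinearMap.norm_compContinuousLinearMap_le _ _).trans ?_
        refine mul_le_one₀ (le_of_eq ContinuousMultilinearMap.norm_mkPiAlgebra)
          (Finset.prod_nonneg fun _ _ => norm_nonneg _)
          (Finset.prod_le_one (fun _ _ => norm_nonneg _) fun i _ => ?_)
        split_ifs
        · exact ContinuousLinearMap.norm_id_le
        · exact le_of_eq Complex.conjCLE_norm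
      calc _ ≤ B ^ n * 1 := mul_le_mul (hx ▸ hc x) h1 (norm_nonneg _) (by positivity)
        _ = _ := mul_one _
    refine (Finset.sum_le_card_nsmul _ _ _ this).trans ?_
    rw [Finset.Nat.card_antidiagonal, nsmul_eq_mul]
    push_cast; rfl
  have hr : 0 < (pp c).radius := by
    refine lt_of_lt_of_le ?_ ((pp c).le_radius_of_bound (r := Real.toNNReal (1 / (2 * B))) 1 ?_)
    · rw [ENNReal.coe_pos, Real.toNNReal_pos]
      positivity
    · intro n
      rw [Real.coe_toNNReal _ (by positivity)]
      have h2 : ((n : ℝ) + 1) ≤ 2 ^ n := by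
        have : n + 1 ≤ 2 ^ n := Nat.lt_two_pow_self
        exact_mod_cast this
      calc _ ≤ (2 ^ n * B ^ n) * (1 / (2 * B)) ^ n := by
            refine mul_le_mul_of_nonneg_right ((hn n).trans ?_) (by positivity)
            gcongr
        _ = 1 := by
            rw [← mul_pow, ← mul_pow, mul_one_div_cancel (by positivity), one_pow]
  have := ((pp c).hasFPowerSeriesOnBall hr).analyticAt
  have e : (pp c).sum = FF c := by
    funext z
    rw [FormalMultilinearSeries.sum, FF]
    simp only [pp_apply]
  rwa [e] at this

theorem FF_polar {c : ℕ × ℕ → ℂ} {h : ℕ → ℝ → ℝ}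
    (hc : ∀ n θ, (h n θ : ℂ) = ∑ x ∈ Finset.HasAntidiagonal.antidiagonal n, c x * ee x.1 x.2 θ)
    (r θ : ℝ) : FF c (r * Complex.exp (θ * Complex.I)) = (Gam h r θ : ℂ) := by
  rw [FF, Gam, Complex.ofReal_tsum]
  congr 1
  funext n
  push_cast
  rw [hc, Finset.sum_mul]
  refine Finset.sum_congr rfl fun x hx => ?_
  have hx := Finset.HasAntidiagonal.mem_antidiagonal.1 hx
  rw [map_mul, conj_exp, Complex.conj_ofReal, ← hx, ee, mul_pow, mul_pow, pow_add]
  ring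

end PL


namespace PL

theorem data (Y : ℂ → ℂ) (hY : AnalyticAt ℝ Y 0) (hY0 : Y 0 = 0)
    (hd : ∀ z, fderiv ℝ Y 0 z = Complex.I * z) :
    ∃ (F a : ℕ → ℝ → ℂ) (C A δ : ℝ), (∀ n, F n ∈ TP n) ∧
      (∀ n θ, a n θ = F (n + 1) θ * Complex.exp (-(θ * Complex.I))) ∧
      (∀ θ, a 0 θ = Complex.I) ∧ (∀ n, Continuous (a n)) ∧ 0 ≤ C ∧ 1 ≤ A ∧
      (∀ m θ, ‖a m θ‖ ≤ C * A ^ m) ∧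
      (∀ m θ, a m (θ + Real.pi) = ((-1 : ℝ) : ℂ) ^ m * a m θ) ∧ 0 < δ ∧
      ∀ r θ : ℝ, r ≠ 0 → |r| < δ →
        HasSum (fun m => a m θ * (r : ℂ) ^ m)
          (Y (r * Complex.exp (θ * Complex.I)) / (r * Complex.exp (θ * Complex.I))) ∧
        Summable fun m => ‖a m θ * (r : ℂ) ^ m‖ := by
  obtain ⟨p, R, hp⟩ := hY
  let F : ℕ → ℝ → ℂ := fun n θ => p n (fun _ => Complex.exp (θ * Complex.I))
  let a : ℕ → ℝ → ℂ := fun n θ => F (n + 1) θ * Complex.exp (-(θ * Complex.I))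
  have hF : ∀ n, F n ∈ TP n := fun n => TP_multilinear n (p n)
  have hexp : ∀ θ : ℝ, Complex.exp (θ * Complex.I) * Complex.exp (-(θ * Complex.I)) = 1 := by
    intro θ; rw [← Complex.exp_add]; simp
  have hnexp : ∀ θ : ℝ, ‖Complex.exp (-((θ : ℂ) * Complex.I))‖ = 1 := by
    intro θ
    rw [show -((θ : ℂ) * Complex.I) = ((-θ : ℝ) : ℂ) * Complex.I by push_cast; ring,
      Complex.norm_exp_ofReal_mul_I]
  obtain ⟨C, A, hC, hA, hb⟩ : ∃ C A : ℝ, 0 < C ∧ 0 < A ∧ ∀ n, ‖p n‖ ≤ C * A ^ n := by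
    obtain ⟨C, r, hC, hr, h⟩ := p.le_mul_pow_of_radius_pos (hp.r_pos.trans_le hp.r_le)
    exact ⟨C, r, hC, hr, h⟩
  have hab : ∀ m θ, ‖a m θ‖ ≤ (C * A) * (A + 1) ^ m := by
    intro m θ
    have h1 : ‖F (m + 1) θ‖ ≤ ‖p (m + 1)‖ := by
      have := (p (m + 1)).le_opNorm (fun _ => Complex.exp (θ * Complex.I))
      simpa [Complex.norm_exp_ofReal_mul_I] using this
    rw [norm_mul, hnexp, mul_one]
    calc _ ≤ _ := h1.trans (hb _)
      _ = (C * A) * A ^ m := by rw [pow_succ]; ring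
      _ ≤ _ := by gcongr; linarith
  obtain ⟨δ1, hδ1, hδ1R⟩ : ∃ δ : ℝ, 0 < δ ∧ ∀ z : ℂ, ‖z‖ < δ → z ∈ Metric.eball (0 : ℂ) R := by
    have := Metric.eball_mem_nhds (0 : ℂ) hp.r_pos
    obtain ⟨δ, h1, h2⟩ := Metric.mem_nhds_iff.1 this
    exact ⟨δ, h1, fun z hz => h2 (by simpa using hz)⟩
  refine ⟨F, a, C * A, A + 1, min δ1 (1 / (2 * (A + 1))), hF, fun _ _ => rfl, ?_, ?_, by positivity,
    by linarith, hab, ?_, by positivity, ?_⟩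
  · intro θ
    have h1 : F 1 θ = Complex.I * Complex.exp (θ * Complex.I) := by
      rw [← hd, hp.hasFPowerSeriesAt.fderiv_eq]
      simp only [F]
      rw [continuousMultilinearCurryFin1_apply]
      congr 1
    change F 1 θ * _ = _
    rw [h1, mul_assoc, hexp, mul_one]
  · intro n
    have : Continuous (F (n + 1)) := (p (n + 1)).cont.comp (by fun_prop)
    exact this.mul (by fun_prop)
  · intro m θ
    have h1 : Complex.exp (((θ + Real.pi : ℝ) : ℂ) * Complex.I) = (-1) * Complex.exp (θ * Complex.I) := by
      push_cast
      rw [add_mul, Complex.exp_add, Complex.exp_pi_mul_I]; ring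
    have h2 : Complex.exp (-(((θ + Real.pi : ℝ) : ℂ) * Complex.I)) = (-1) * Complex.exp (-(θ * Complex.I)) := by
      rw [Complex.exp_neg, h1, Complex.exp_neg, mul_inv]; norm_num
    simp only [a]
    rw [TP_sign (hF _), h2, pow_succ]
    push_cast
    ring
  · intro r θ hr0 hr
    have hr1 : |r| < δ1 := hr.trans_le (min_le_left _ _)
    have hr2 : |r| < 1 / (2 * (A + 1)) := hr.trans_le (min_le_right _ _)
    have hrC : (r : ℂ) ≠ 0 := by exact_mod_cast hr0
    constructor
    · have hz : ‖(r : ℂ) * Complex.exp (θ * Complex.I)‖ < δ1 := by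
        rw [norm_mul, Complex.norm_exp_ofReal_mul_I, mul_one, Complex.norm_real]
        exact hr1
      have hs := hp.hasSum (hδ1R _ hz)
      rw [zero_add] at hs
      have hpn : ∀ n, p n (fun _ => (r : ℂ) * Complex.exp (θ * Complex.I)) = (r : ℂ) ^ n * F n θ := by
        intro n
        have := (p n).map_smul_univ (fun _ => r) (fun _ => Complex.exp (θ * Complex.I))
        simp only [Complex.real_smul, Finset.prod_const, Finset.card_univ, Fintype.card_fin] at this
        rw [this]; push_cast; rfl
      simp only [hpn] at hs
      have h0 : F 0 θ = 0 := by
        have := hp.coeff_zero (fun _ => Complex.exp (θ * Complex.I))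
        rw [hY0] at this
        exact this
      have hs' := (hasSum_nat_add_iff' (f := fun n => (r : ℂ) ^ n * F n θ) 1).2 hs
      simp only [Finset.sum_range_one, h0, mul_zero, sub_zero] at hs'
      have hs2 := hs'.div_const ((r : ℂ) * Complex.exp (θ * Complex.I))
      have e : (fun m => a m θ * (r : ℂ) ^ m) = fun i => (r : ℂ) ^ (i + 1) * F (i + 1) θ /
          ((r : ℂ) * Complex.exp (θ * Complex.I)) := by
        funext m
        simp only [a]
        rw [Complex.exp_neg]
        have := Complex.exp_ne_zero (θ * Complex.I)
        field_simp
        try ring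
      rw [e]
      exact hs2
    · have h0 : Summable fun m : ℕ => (C * A) * (1 / 2 : ℝ) ^ m := summable_geometric_two.mul_left _
      refine Summable.of_nonneg_of_le (fun _ => norm_nonneg _) (fun m => ?_) h0
      rw [norm_mul, norm_pow, Complex.norm_real, Real.norm_eq_abs]
      calc _ ≤ ((C * A) * (A + 1) ^ m) * (1 / (2 * (A + 1))) ^ m := by
            gcongr
            exact hab m θ
        _ = (C * A) * (1 / 2) ^ m := by
            rw [mul_assoc, ← mul_pow]; congr 2; field_simp

theorem lift (Y : ℂ → ℂ) {δ : ℝ} (hYc : ContinuousOn Y (Metric.ball 0 δ)) (c : ℝ → ℂ)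
    (hc : ∀ t, HasDerivAt c (Y (c t)) t) (h0 : ∀ t, c t ≠ 0) (hδ : ∀ t, ‖c t‖ < δ) :
    ∃ θ : ℝ → ℝ, (∀ t, c t = (‖c t‖ : ℂ) * Complex.exp (θ t * Complex.I)) ∧
      (∀ t, HasDerivAt (fun s => ‖c s‖) (‖c t‖ * (Y (c t) / c t).re) t) ∧
      (∀ t, HasDerivAt θ ((Y (c t) / c t).im) t) := by
  have hcc : Continuous c := continuous_iff_continuousAt.2 fun t => (hc t).continuousAt
  have hq : Continuous fun t => Y (c t) / c t := by
    refine Continuous.div ?_ hcc h0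
    exact hYc.comp_continuous hcc (fun t => by simpa using hδ t)
  let ℓ : ℝ → ℂ := fun t => Complex.log (c 0) + ∫ s in (0 : ℝ)..t, Y (c s) / c s
  have hℓ : ∀ t, HasDerivAt ℓ (Y (c t) / c t) t := fun t =>
    ((hq.integral_hasStrictDerivAt 0 t).hasDerivAt).const_add _
  have hconst : ∀ t, HasDerivAt (fun t => c t * Complex.exp (-(ℓ t))) 0 t := by
    intro t
    refine ((hc t).mul (hℓ t).neg.cexp).congr_deriv ?_
    have := h0 t
    simp only [Pi.neg_apply]
    field_simp
    ring
  have hexp : ∀ t, c t = Complex.exp (ℓ t) := by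
    intro t
    have := is_const_of_deriv_eq_zero (fun x => (hconst x).differentiableAt)
      (fun x => (hconst x).deriv) t 0
    have e0 : c 0 * Complex.exp (-(ℓ 0)) = 1 := by
      simp only [ℓ, intervalIntegral.integral_same, add_zero]
      rw [Complex.exp_neg, Complex.exp_log (h0 0), mul_inv_cancel₀ (h0 0)]
    rw [e0, Complex.exp_neg] at this
    have h2 := Complex.exp_ne_zero (ℓ t)
    field_simp at this
    exact this
  have hnorm : ∀ t, ‖c t‖ = Real.exp (ℓ t).re := by
    intro t; rw [hexp t, Complex.norm_exp]
  have hre : ∀ t, HasDerivAt (fun t => (ℓ t).re) (Y (c t) / c t).re t := fun t =>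
    (Complex.reCLM.hasFDerivAt (x := ℓ t)).comp_hasDerivAt t (hℓ t)
  have him : ∀ t, HasDerivAt (fun t => (ℓ t).im) (Y (c t) / c t).im t := fun t =>
    (Complex.imCLM.hasFDerivAt (x := ℓ t)).comp_hasDerivAt t (hℓ t)
  refine ⟨fun t => (ℓ t).im, fun t => ?_, fun t => ?_, him⟩
  · rw [hnorm, Complex.ofReal_exp, ← Complex.exp_add, Complex.re_add_im, ← hexp]
  · have e : (fun s => ‖c s‖) = fun s => Real.exp (ℓ s).re := by funext s; exact hnorm s
    rw [e, hnorm]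
    exact (hre t).exp

theorem gam_zero {g : ℕ → ℝ → ℝ} (h : ∀ n, g n 0 = if n = 1 then 1 else 0) (r : ℝ) :
    Gam g r 0 = r := by
  rw [Gam, tsum_eq_single 1]
  · simp [h]
  · intro n hn; simp [h, hn]

theorem returns (Y : ℂ → ℂ) {a : ℕ → ℝ → ℂ} {g d : ℕ → ℝ → ℝ} (hs : Sol a g d) {B δ : ℝ}
    (hB : 0 < B)
    (hg : ∀ n θ, |θ| < 10 → |g n θ| ≤ B ^ n) (hd : ∀ n θ, |θ| < 10 → |d n θ| ≤ B ^ n)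
    (hg0 : ∀ n, g n 0 = if n = 1 then 1 else 0)
    (hδB : δ ≤ 1 / (2 * B)) (hYc : ContinuousOn Y (Metric.ball 0 δ))
    (hser : ∀ r θ : ℝ, r ≠ 0 → |r| < δ →
        HasSum (fun m => a m θ * (r : ℂ) ^ m)
          (Y (r * Complex.exp (θ * Complex.I)) / (r * Complex.exp (θ * Complex.I))) ∧
        Summable fun m => ‖a m θ * (r : ℂ) ^ m‖)
    (hrot : ∀ z : ℂ, z ≠ 0 → ‖z‖ < δ → 1 / 2 ≤ (Y z / z).im)
    (c : ℝ → ℂ) (hc : ∀ t, HasDerivAt c (Y (c t)) t) (h0 : ∀ t, c t ≠ 0) (hδ : ∀ t, ‖c t‖ < δ) :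
    ∃ t : ℤ → ℝ, (∀ n, t n < t (n + 1)) ∧ (∀ n, c (t n) = ‖c (t n)‖) ∧
      ∀ n, ‖c (t n)‖ = Gam g ‖c (t (n + 1))‖ (2 * Real.pi) := by
  obtain ⟨θ, hpol, hr', hθ'⟩ := lift Y hYc c hc h0 hδ
  have hθd : Differentiable ℝ θ := fun t => (hθ' t).differentiableAt
  have hder : ∀ t, 1 / 2 ≤ deriv θ t := fun t => by
    rw [(hθ' t).deriv]; exact hrot _ (h0 t) (hδ t)
  have hmono : StrictMono θ := strictMono_of_deriv_pos fun t => by linarith [hder t]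
  have hlow : ∀ x y, x ≤ y → 1 / 2 * (y - x) ≤ θ y - θ x :=
    fun x y hxy => mul_sub_le_image_sub_of_le_deriv hθd hder hxy
  have hsurj : Function.Surjective θ := by
    intro v
    have h1 : ∃ x, θ x ≤ v := by
      refine ⟨min 0 (-(2 * (θ 0 - v))), ?_⟩
      have := hlow _ _ (min_le_left 0 (-(2 * (θ 0 - v))))
      have := min_le_right 0 (-(2 * (θ 0 - v)))
      linarith
    have h2 : ∃ x, v ≤ θ x := by
      refine ⟨max 0 (2 * (v - θ 0)), ?_⟩
      have := hlow _ _ (le_max_left 0 (2 * (v - θ 0)))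
      have := le_max_right 0 (2 * (v - θ 0))
      linarith
    obtain ⟨x, hx⟩ := h1
    obtain ⟨y, hy⟩ := h2
    exact mem_range_of_exists_le_of_exists_ge hθd.continuous ⟨x, hx⟩ ⟨y, hy⟩
  choose τ hτ using hsurj
  have hpi := Real.pi_pos
  have hexpn : ∀ (n : ℤ) (s : ℝ), Complex.exp (((s - 2 * Real.pi * n : ℝ) : ℂ) * Complex.I) =
      Complex.exp (s * Complex.I) := by
    intro n s
    push_cast
    rw [sub_mul, Complex.exp_sub, show 2 * (Real.pi : ℂ) * n * Complex.I = n * (2 * Real.pi * Complex.I) by ring,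
      Complex.exp_int_mul_two_pi_mul_I, div_one]
  refine ⟨fun n => τ (2 * Real.pi * n), fun n => ?_, fun n => ?_, fun n => ?_⟩
  · rw [← hmono.lt_iff_lt, hτ, hτ]
    push_cast; linarith
  · have h1 := hpol (τ (2 * Real.pi * n))
    rw [hτ] at h1
    have := hexpn n (2 * Real.pi * n)
    rw [← this] at h1
    simpa using h1
  · set t0 := τ (2 * Real.pi * n) with ht0
    set t1 := τ (2 * Real.pi * ((n + 1 : ℤ) : ℝ)) with ht1
    have e0 : θ t0 = 2 * Real.pi * n := hτ _
    have e1 : θ t1 = 2 * Real.pi * n + 2 * Real.pi := by rw [ht1, hτ]; push_cast; ring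
    have hlt : t0 ≤ t1 := by
      rw [← hmono.le_iff_le, e0, e1]; linarith
    have hpi4 := Real.pi_lt_four
    have hpi2 : 2 * Real.pi < 10 := by have := Real.pi_lt_d2; linarith
    let φ : ℝ → ℝ := fun s => Gam g ‖c s‖ (θ s - 2 * Real.pi * n)
    have hφ : ∀ s ∈ Set.Icc t0 t1, HasDerivAt φ 0 s := by
      intro s hs'
      have u1 := hmono.monotone hs'.1
      have u2 := hmono.monotone hs'.2
      rw [e0] at u1
      rw [e1] at u2
      have hab : |θ s - 2 * Real.pi * n| < 10 := by
        rw [abs_lt]; constructor <;> linarith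
      have hr : |‖c s‖| < 1 / (2 * B) := by
        rw [abs_norm]; exact (hδ s).trans_le hδB
      obtain ⟨D, hD, hD0⟩ := gam_hasFDerivAt hs hB hg hd hr hab
      have hh := hser ‖c s‖ (θ s - 2 * Real.pi * n) (norm_ne_zero_iff.2 (h0 s))
        (by rw [abs_norm]; exact hδ s)
      rw [hexpn, ← hpol s] at hh
      have hz := hD0 _ hh.1 hh.2
      have hcurve : HasDerivAt (fun s => (‖c s‖, θ s - 2 * Real.pi * n))
        (‖c s‖ * (Y (c s) / c s).re, (Y (c s) / c s).im) s :=
        (hr' s).prodMk ((hθ' s).sub_const _)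
      have := HasFDerivAt.comp_hasDerivAt (x := s) (f := fun s => (‖c s‖, θ s - 2 * Real.pi * n)) hD hcurve
      rw [hz] at this
      exact this
    have hcst := constant_of_has_deriv_right_zero (f := φ) (a := t0) (b := t1)
      (fun s hs' => (hφ s hs').continuousAt.continuousWithinAt)
      (fun s hs' => (hφ s (Set.Ico_subset_Icc_self hs')).hasDerivWithinAt) t1 ⟨hlt, le_rfl⟩
    simp only [φ] at hcst
    rw [e0, e1, sub_self, gam_zero hg0, add_sub_cancel_left] at hcst
    exact hcst.symm

end PL


namespace PL

theorem gam_series {g : ℕ → ℝ → ℝ} {B θ : ℝ} (hB : 0 < B) (hg : ∀ n, |g n θ| ≤ B ^ n) :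
    HasFPowerSeriesAt (fun r => Gam g r θ)
      (FormalMultilinearSeries.ofScalars ℝ (fun n => g n θ)) 0 := by
  rw [hasFPowerSeriesAt_iff]
  have : Metric.ball (0 : ℝ) (1 / (2 * B)) ∈ nhds (0 : ℝ) := Metric.ball_mem_nhds _ (by positivity)
  filter_upwards [this] with r hr
  have hr' : |r| ≤ 1 / (2 * B) := by
    have := Metric.mem_ball.1 hr
    rw [Real.dist_eq, sub_zero] at this
    exact this.le
  have h := (gam_summable hB hr' hg).of_norm.hasSum
  rw [zero_add]
  simp only [FormalMultilinearSeries.coeff_ofScalars, smul_eq_mul]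
  simp only [mul_comm] at h ⊢
  simpa [Gam, mul_comm] using h

theorem gam_coeff {g g2 : ℕ → ℝ → ℝ} {B θ B2 θ2 : ℝ} (hB : 0 < B) (hg : ∀ n, |g n θ| ≤ B ^ n)
    (hB2 : 0 < B2) (hg2 : ∀ n, |g2 n θ2| ≤ B2 ^ n)
    (h : ∀ᶠ r in nhds (0 : ℝ), Gam g r θ = Gam g2 r θ2) (n : ℕ) : g n θ = g2 n θ2 := by
  have h1 := (gam_series hB hg).congr h
  have h2 := h1.eq_formalMultilinearSeries (gam_series hB2 hg2)
  have h3 := congrArg (fun p : FormalMultilinearSeries ℝ ℝ ℝ => p.coeff n) h2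
  simpa [FormalMultilinearSeries.coeff_ofScalars] using h3

/-- no monotone returns -/
theorem no_fix {P : ℝ → ℝ} {δ : ℝ} (hP : ContinuousOn P (Set.Ioo 0 δ))
    (hne : ∀ r ∈ Set.Ioo 0 δ, P r ≠ r) (ρ : ℤ → ℝ) (η : ℝ) (hη : η < δ) (h0 : ∀ n, 0 < ρ n)
    (h1 : ∀ n, ρ n ≤ η) (h : ∀ n, ρ n = P (ρ (n + 1))) : False := by
  have hmem : ∀ n, ρ n ∈ Set.Ioo 0 δ := fun n => ⟨h0 n, (h1 n).trans_lt hη⟩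
  have key : ∀ s : ℕ → ℝ, Monotone s → (∀ n, ∃ m, s n = ρ m) →
      ((∀ n, s n = P (s (n + 1))) ∨ (∀ n, s (n + 1) = P (s n))) → False := by
    intro s hs hm hor
    have hbdd : BddAbove (Set.range s) := ⟨η, by
      rintro _ ⟨n, rfl⟩
      obtain ⟨m, hm⟩ := hm n
      rw [hm]; exact h1 m⟩
    have hl := tendsto_atTop_ciSup hs hbdd
    set l := ⨆ i, s i
    have hl1 : l ≤ η := ciSup_le fun n => by
      obtain ⟨m, hm⟩ := hm n
      rw [hm]; exact h1 m
    have hl0 : 0 < l := by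
      obtain ⟨m, hm⟩ := hm 0
      exact (hm ▸ h0 m : 0 < s 0).trans_le (le_ciSup hbdd 0)
    have hlm : l ∈ Set.Ioo 0 δ := ⟨hl0, hl1.trans_lt hη⟩
    have hc : Filter.Tendsto P (nhds l) (nhds (P l)) :=
      hP.continuousAt (Ioo_mem_nhds hlm.1 hlm.2)
    have hl' := hl.comp (Filter.tendsto_add_atTop_nat 1)
    refine hne l hlm ?_
    rcases hor with hor | hor
    · have := hc.comp hl'
      refine tendsto_nhds_unique this ?_
      refine hl.congr (fun n => ?_)
      exact hor n
    · have := hc.comp hl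
      refine tendsto_nhds_unique this ?_
      refine hl'.congr (fun n => ?_)
      exact hor n
  have hsign : (∀ r ∈ Set.Ioo 0 δ, P r < r) ∨ (∀ r ∈ Set.Ioo 0 δ, r < P r) := by
    by_contra hcon
    push Not at hcon
    obtain ⟨⟨x, hx, hx'⟩, y, hy, hy'⟩ := hcon
    have hc2 : ContinuousOn (fun r => P r - r) (Set.Ioo 0 δ) := hP.sub continuousOn_id
    have := isPreconnected_Ioo.intermediate_value hy hx hc2
    obtain ⟨z, hz, hz'⟩ := this (show (0 : ℝ) ∈ Set.Icc _ _ from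
      ⟨by linarith, by linarith⟩)
    exact hne z hz (by simp only at hz'; linarith)
  rcases hsign with hsg | hsg
  · refine key (fun n => ρ n) (monotone_nat_of_le_succ fun n => ?_) (fun n => ⟨_, rfl⟩) (Or.inl fun n => ?_)
    · rw [h]; push_cast; exact (hsg _ (hmem _)).le
    · rw [h]; push_cast; rfl
  · refine key (fun n => ρ (-n)) (monotone_nat_of_le_succ fun n => ?_) (fun n => ⟨_, rfl⟩) (Or.inr fun n => ?_)
    · rw [h (-((n + 1 : ℕ) : ℤ))]; push_cast
      rw [show -((n : ℤ) + 1) + 1 = -n by ring]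
      exact (hsg _ (hmem _)).le
    · rw [h (-((n + 1 : ℕ) : ℤ))]; push_cast
      rw [show -((n : ℤ) + 1) + 1 = -n by ring]

theorem bounds {a : ℕ → ℝ → ℂ} (ha : ∀ m, Continuous (a m)) (C A : ℝ) (hC : 0 ≤ C) (hA : 1 ≤ A)
    (hb : ∀ m θ, ‖a m θ‖ ≤ C * A ^ m) : ∃ B : ℝ, 0 < B ∧
    (∀ n θ, |θ| < 10 → |gg a n θ| ≤ B ^ n) ∧ (∀ n θ, |θ| < 10 → |dd a n θ| ≤ B ^ n) := by
  have hK : 0 < A * (1 + 2 * C) := by positivity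
  have hexp : ∀ (n : ℕ) (θ : ℝ), |θ| < 10 → Real.exp (n * |θ|) ≤ Real.exp 10 ^ n := by
    intro n θ hθ
    rw [← Real.exp_nat_mul]
    apply Real.exp_le_exp.2
    exact mul_le_mul_of_nonneg_left hθ.le (Nat.cast_nonneg n)
  refine ⟨2 * (A * (1 + 2 * C)) * Real.exp 10, by positivity, fun n θ hθ => ?_, fun n θ hθ => ?_⟩
  · refine ((gg_bound a ha C A hC hA hb n θ).2).trans ?_
    generalize A * (1 + 2 * C) = K at hK
    rw [mul_pow (2 * K)]
    have h3 := hexp n θ hθ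
    gcongr
    linarith
  · refine ((gg_bound a ha C A hC hA hb n θ).1).trans ?_
    generalize A * (1 + 2 * C) = K at hK
    rw [mul_pow, mul_pow]
    have h2 : (n : ℝ) ≤ 2 ^ n := by exact_mod_cast Nat.lt_two_pow_self.le
    have h3 := hexp n θ hθ
    gcongr

end PL


namespace PL

structure Setup (Y : ℂ → ℂ) (F a : ℕ → ℝ → ℂ) (g d : ℕ → ℝ → ℝ) (B δ : ℝ) : Prop where
  hF : ∀ n, F n ∈ TP n
  hA : ∀ n θ, a n θ = F (n + 1) θ * Complex.exp (-(θ * Complex.I))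
  ha0 : ∀ θ, a 0 θ = Complex.I
  hsh : ∀ m θ, a m (θ + Real.pi) = ((-1 : ℝ) : ℂ) ^ m * a m θ
  hs : Sol a g d
  hB : 0 < B
  hg : ∀ n θ, |θ| < 10 → |g n θ| ≤ B ^ n
  hd : ∀ n θ, |θ| < 10 → |d n θ| ≤ B ^ n
  hg0 : ∀ n, g n 0 = if n = 1 then 1 else 0
  hδ : 0 < δ
  hδB : δ ≤ 1 / (2 * B)
  hser : ∀ r θ : ℝ, r ≠ 0 → |r| < δ →
        HasSum (fun m => a m θ * (r : ℂ) ^ m)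
          (Y (r * Complex.exp (θ * Complex.I)) / (r * Complex.exp (θ * Complex.I))) ∧
        Summable fun m => ‖a m θ * (r : ℂ) ^ m‖
  hrot : ∀ z : ℂ, z ≠ 0 → ‖z‖ < δ → 1 / 2 ≤ (Y z / z).im
  hlip : ∃ K, LipschitzOnWith K Y (Metric.ball 0 δ)

theorem setup (Y : ℂ → ℂ) (hY : AnalyticAt ℝ Y 0) (hY0 : Y 0 = 0)
    (hd : ∀ z, fderiv ℝ Y 0 z = Complex.I * z) :
    ∃ F a g d B δ, Setup Y F a g d B δ := by
  obtain ⟨F, a, C, A, δ, hF, hA, ha0, hac, hC, hA1, hab, hsh, hδ, hser⟩ := data Y hY hY0 hd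
  obtain ⟨B, hB, hg, hdd⟩ := bounds hac C A hC hA1 hab
  have ho := hY.differentiableAt.hasFDerivAt.isLittleO.def (show (0 : ℝ) < 1 / 2 by norm_num)
  obtain ⟨δ1, hδ1, h1⟩ := Metric.eventually_nhds_iff.1 ho
  obtain ⟨K, s, hs, hK⟩ := (hY.contDiffAt (n := 1)).exists_lipschitzOnWith
  obtain ⟨δ2, hδ2, h2⟩ := Metric.mem_nhds_iff.1 hs
  have l1 : min (min δ δ1) (min δ2 (1 / (2 * B))) ≤ δ := (min_le_left _ _).trans (min_le_left _ _)
  have l2 : min (min δ δ1) (min δ2 (1 / (2 * B))) ≤ δ1 := (min_le_left _ _).trans (min_le_right _ _)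
  have l3 : min (min δ δ1) (min δ2 (1 / (2 * B))) ≤ δ2 := (min_le_right _ _).trans (min_le_left _ _)
  have l4 : min (min δ δ1) (min δ2 (1 / (2 * B))) ≤ 1 / (2 * B) := (min_le_right _ _).trans (min_le_right _ _)
  refine ⟨F, a, gg a, dd a, B, min (min δ δ1) (min δ2 (1 / (2 * B))), hF, hA, ha0, hsh,
    gg_sol a hac ha0, hB, hg, hdd, gg_zero a, by positivity, l4,
    fun r θ h0 hr => hser r θ h0 (hr.trans_le l1), ?_, K, hK.mono ?_⟩
  · intro z hz hz'
    have := h1 (y := z) (by simpa using hz'.trans_le l2)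
    rw [hY0, sub_zero, sub_zero, hd] at this
    have e : Y z / z = Complex.I + (Y z - Complex.I * z) / z := by field_simp; ring
    have hn : ‖(Y z - Complex.I * z) / z‖ ≤ 1 / 2 := by
      rw [norm_div, div_le_iff₀ (norm_pos_iff.2 hz)]; exact this
    have := (Complex.abs_im_le_norm _).trans hn
    rw [e, Complex.add_im, Complex.I_im]
    linarith [(abs_le.1 this).1]
  · exact (Metric.ball_subset_ball l3).trans h2

variable {Y : ℂ → ℂ} {F a : ℕ → ℝ → ℂ} {g d : ℕ → ℝ → ℝ} {B δ : ℝ}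

theorem two_pi_lt : 2 * Real.pi < 13 / 2 := by have := Real.pi_lt_d2; linarith

theorem abs_two_pi : |2 * Real.pi| < 10 := by
  rw [abs_of_pos Real.two_pi_pos]; linarith [two_pi_lt]

theorem per0 (S : Setup Y F a g d B δ)
    (horb : ∀ η > (0 : ℝ), ∃ c : ℝ → ℂ, (∀ t, HasDerivAt c (Y (c t)) t) ∧ ∀ t, c t ≠ 0 ∧ ‖c t‖ < η)
    (n : ℕ) : g n (2 * Real.pi) = g n 0 := by
  obtain ⟨K, hK⟩ := S.hlip
  have hser := gam_series S.hB (fun n => S.hg n _ abs_two_pi)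
  have han : AnalyticAt ℝ (fun r => Gam g r (2 * Real.pi)) 0 := ⟨_, hser⟩
  have h0 : |(0 : ℝ)| < 10 := by norm_num
  rcases (han.sub analyticAt_id).eventually_eq_zero_or_eventually_ne_zero with h | h
  · refine gam_coeff S.hB (fun n => S.hg n _ abs_two_pi) S.hB (fun n => S.hg n _ h0) ?_ n
    filter_upwards [h] with r hr
    rw [gam_zero S.hg0]
    simpa [sub_eq_zero] using hr
  · exfalso
    rw [eventually_nhdsWithin_iff] at h
    obtain ⟨η, hη, hh⟩ := Metric.eventually_nhds_iff.1 (h.and han.eventually_analyticAt)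
    obtain ⟨c, hc, hc'⟩ := horb (min δ (η / 2)) (by have := S.hδ; positivity)
    obtain ⟨t, -, -, ht⟩ := returns Y S.hs S.hB S.hg S.hd S.hg0 S.hδB hK.continuousOn S.hser S.hrot c hc
      (fun t => (hc' t).1) (fun t => (hc' t).2.trans_le (min_le_left _ _))
    refine no_fix (P := fun r => Gam g r (2 * Real.pi)) (δ := η) ?_ ?_ (fun n => ‖c (t n)‖) (η / 2)
      (by linarith) (fun n => norm_pos_iff.2 (hc' _).1)
      (fun n => ((hc' _).2.trans_le (min_le_right _ _)).le) ht
    · intro r hr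
      exact (hh (y := r) (by rw [Real.dist_eq, sub_zero, abs_of_pos hr.1]; exact hr.2)).2.continuousAt.continuousWithinAt
    · intro r hr
      have := (hh (y := r) (by rw [Real.dist_eq, sub_zero, abs_of_pos hr.1]; exact hr.2)).1 hr.1.ne'
      simpa [sub_eq_zero] using this

theorem per (S : Setup Y F a g d B δ) (h : ∀ n, g n (2 * Real.pi) = g n 0) (n : ℕ) (θ : ℝ) :
    g n (θ + 2 * Real.pi) = g n θ := by
  have h1 := S.hs.shift (2 * Real.pi) 1 (fun m θ => by
    rw [show θ + 2 * Real.pi = θ + Real.pi + Real.pi by ring, S.hsh, S.hsh, ← mul_assoc, ← mul_pow]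
    norm_num) (by norm_num)
  have h2 := (Sol.uniq S.ha0 h1 S.hs (fun n => by simp [h]) n).1 θ
  simpa using h2

theorem center (S : Setup Y F a g d B δ) (h : ∀ n, g n (2 * Real.pi) = g n 0) (c : ℝ → ℂ)
    (hc : ∀ t, HasDerivAt c (Y (c t)) t) (hc' : ∀ t, c t ≠ 0 ∧ ‖c t‖ < δ) :
    ∃ T > (0 : ℝ), ∀ t, c (t + T) = c t := by
  obtain ⟨K, hK⟩ := S.hlip
  obtain ⟨t, ht1, ht2, ht3⟩ := returns Y S.hs S.hB S.hg S.hd S.hg0 S.hδB hK.continuousOn S.hser S.hrot c hc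
      (fun t => (hc' t).1) (fun t => (hc' t).2)
  have e1 : ‖c (t 0)‖ = ‖c (t 1)‖ := by
    rw [ht3 0, ← gam_zero S.hg0 ‖c (t 1)‖]
    simp only [Gam, h, zero_add]
  have e2 : c (t 0) = c (t 1) := by rw [ht2 0, ht2 1, e1]
  refine ⟨t 1 - t 0, by have := ht1 0; rw [zero_add] at this; linarith, fun s => ?_⟩
  have := ODE_solution_unique_univ (v := fun _ => Y) (s := fun _ => Metric.ball 0 δ) (K := K)
    (f := fun s => c (s + (t 1 - t 0))) (g := c) (t₀ := t 0) (fun _ => hK)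
    (fun s => ⟨(hc _).comp_add_const s _, by simpa using (hc' _).2⟩)
    (fun s => ⟨hc s, by simpa using (hc' _).2⟩) (by
      change c (t 0 + (t 1 - t 0)) = c (t 0)
      rw [e2]; congr 1; ring)
  exact congrFun this s

theorem nat_bound (n : ℕ) : ((n : ℝ) + 1) ≤ 2 ^ n := by
  exact_mod_cast Nat.lt_two_pow_self (n := n)

theorem integral (S : Setup Y F a g d B δ) (hY0 : Y 0 = 0) (h : ∀ n, g n (2 * Real.pi) = g n 0) :
    ∃ f : ℂ → ℝ, AnalyticAt ℝ f 0 ∧ ¬ (f =ᶠ[nhds (0 : ℂ)] fun _ => f 0) ∧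
      ∀ᶠ p in nhds (0 : ℂ), fderiv ℝ f p (Y p) = 0 := by
  have hB := S.hB
  have hper := per S h
  have hsh := S.hs.shift Real.pi (-1) S.hsh (by norm_num)
  have hP := S.hs.prod hsh
  set H : ℕ → ℝ → ℝ := fun n θ => ∑ x ∈ Finset.HasAntidiagonal.antidiagonal n,
    g x.1 θ * ((-1) ^ x.2 * g x.2 (θ + Real.pi)) with hH
  set D : ℕ → ℝ → ℝ := fun n θ => ∑ x ∈ Finset.HasAntidiagonal.antidiagonal n,
    (d x.1 θ * ((-1) ^ x.2 * g x.2 (θ + Real.pi)) + g x.1 θ * ((-1) ^ x.2 * d x.2 (θ + Real.pi))) with hD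
  have hP' : Sol a H D := hP
  have hsign : ∀ n θ, H n (θ + Real.pi) = (-1) ^ n * H n θ := by
    intro n θ
    simp only [hH]
    rw [Finset.mul_sum]
    refine Finset.sum_nbij' Prod.swap Prod.swap ?_ ?_ ?_ ?_ ?_
    · intro x hx
      rw [Finset.HasAntidiagonal.mem_antidiagonal] at hx ⊢
      simp only [Prod.fst_swap, Prod.snd_swap]; omega
    · intro x hx
      rw [Finset.HasAntidiagonal.mem_antidiagonal] at hx ⊢
      simp only [Prod.fst_swap, Prod.snd_swap]; omega
    · intro x _; simp
    · intro x _; simp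
    · intro x hx
      rw [Finset.HasAntidiagonal.mem_antidiagonal] at hx
      simp only [Prod.fst_swap, Prod.snd_swap]
      rw [show θ + Real.pi + Real.pi = θ + 2 * Real.pi by ring, hper, ← hx, pow_add]
      have : ((-1 : ℝ)) ^ x.1 * (-1) ^ x.1 = 1 := by rw [← mul_pow]; norm_num
      linear_combination (-(g x.1 (θ + Real.pi) * (-1) ^ x.2 * g x.2 θ)) * this
  have hab : ∀ θ : ℝ, |θ| < 13 / 2 → |θ| < 10 ∧ |θ + Real.pi| < 10 := by
    intro θ hθ
    have := Real.pi_lt_d2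
    have := Real.pi_pos
    rw [abs_lt] at hθ
    constructor <;> rw [abs_lt] <;> constructor <;> linarith
  have hterm : ∀ (i j n : ℕ) (x y : ℝ), i + j = n → |x| ≤ B ^ i → |y| ≤ B ^ j →
      |x * ((-1) ^ j * y)| ≤ B ^ n := by
    intro i j n x y hij hx hy
    rw [abs_mul, abs_mul, abs_pow, abs_neg, abs_one, one_pow, one_mul, ← hij, pow_add]
    gcongr
  have hHb2 : ∀ n θ, |θ| < 13 / 2 → |H n θ| ≤ (2 * B) ^ n := by
    intro n θ hθ
    obtain ⟨u1, u2⟩ := hab θ hθ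
    calc |H n θ| ≤ ∑ x ∈ Finset.HasAntidiagonal.antidiagonal n, B ^ n := by
          refine (Finset.abs_sum_le_sum_abs _ _).trans (Finset.sum_le_sum fun x hx => ?_)
          rw [Finset.HasAntidiagonal.mem_antidiagonal] at hx
          exact hterm _ _ _ _ _ hx (S.hg _ _ u1) (S.hg _ _ u2)
      _ = (n + 1) * B ^ n := by
          rw [Finset.sum_const, Finset.Nat.card_antidiagonal, nsmul_eq_mul]; push_cast; ring
      _ ≤ 2 ^ n * B ^ n := by gcongr; exact nat_bound n
      _ = _ := by rw [mul_pow]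
  have hHb : ∀ n θ, |θ| < 13 / 2 → |H n θ| ≤ (4 * B) ^ n := by
    intro n θ hθ
    refine (hHb2 n θ hθ).trans ?_
    gcongr; norm_num
  have hDb : ∀ n θ, |θ| < 13 / 2 → |D n θ| ≤ (4 * B) ^ n := by
    intro n θ hθ
    obtain ⟨u1, u2⟩ := hab θ hθ
    rcases Nat.eq_zero_or_pos n with rfl | hn
    · have := hP'.d_eq S.ha0 0 θ
      rw [this]; simp
    calc |D n θ| ≤ ∑ x ∈ Finset.HasAntidiagonal.antidiagonal n, (B ^ n + B ^ n) := by
          refine (Finset.abs_sum_le_sum_abs _ _).trans (Finset.sum_le_sum fun x hx => ?_)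
          rw [Finset.HasAntidiagonal.mem_antidiagonal] at hx
          exact (abs_add_le _ _).trans (add_le_add (hterm _ _ _ _ _ hx (S.hd _ _ u1) (S.hg _ _ u2))
            (hterm _ _ _ _ _ hx (S.hg _ _ u1) (S.hd _ _ u2)))
      _ = ((n + 1) * 2) * B ^ n := by
          rw [Finset.sum_const, Finset.Nat.card_antidiagonal, nsmul_eq_mul]; push_cast; ring
      _ ≤ (2 ^ n * 2 ^ n) * B ^ n := by
          gcongr
          · exact nat_bound n
          · calc (2 : ℝ) = 2 ^ 1 := by norm_num
              _ ≤ 2 ^ n := pow_le_pow_right₀ (by norm_num) hn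
      _ = _ := by rw [← mul_pow, ← mul_pow]; norm_num
  have hpoly := fun n => TP_sum (poly S.hF S.hA S.ha0 hP' hsign n)
  choose cc hcc using hpoly
  let c : ℕ × ℕ → ℂ := fun x => cc (x.1 + x.2) x
  have hc : ∀ n θ, (H n θ : ℂ) = ∑ x ∈ Finset.HasAntidiagonal.antidiagonal n, c x * ee x.1 x.2 θ := by
    intro n θ
    refine (congrFun (hcc n) θ).trans (Finset.sum_congr rfl fun x hx => ?_)
    rw [Finset.HasAntidiagonal.mem_antidiagonal] at hx
    simp only [c, hx]
  have hcb : ∀ x, ‖c x‖ ≤ (4 * B) ^ (x.1 + x.2) := by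
    intro x
    refine fourier_bound (n := x.1 + x.2) (c := c) (fun θ h1 h2 => ?_) x rfl
    rw [← hc, Complex.norm_real, Real.norm_eq_abs]
    exact hHb _ _ (by rw [abs_of_nonneg h1]; linarith [two_pi_lt])
  have hFF := FF_analytic (by positivity) hcb
  have hpolar := FF_polar hc
  have hf : AnalyticAt ℝ (fun z => (FF c z).re) 0 :=
    (Complex.reCLM.analyticAt _).comp hFF
  have hfp : ∀ r θ : ℝ, (FF c (r * Complex.exp (θ * Complex.I))).re = Gam H r θ := by
    intro r θ; rw [hpolar, Complex.ofReal_re]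
  refine ⟨fun z => (FF c z).re, hf, ?_, ?_⟩
  · intro hcon
    have h0 : |(0 : ℝ)| < 13 / 2 := by norm_num
    have hH0 : ∀ n, H n 0 = (fun (n : ℕ) (_ : ℝ) => if n = 0 then H 0 0 else 0) n 0 := by
      refine gam_coeff (g2 := fun (n : ℕ) (_ : ℝ) => if n = 0 then H 0 0 else 0)
        (B2 := 4 * B) (B := 4 * B) (θ2 := 0) (by positivity) (fun n => hHb n 0 h0) (by positivity)
        (fun n => ?_) ?_
      · by_cases hn : n = 0
        · subst hn; simpa using hHb 0 0 h0
        · simp only [hn, if_false, abs_zero]; positivity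
      · have hcont : Filter.Tendsto (fun r : ℝ => (r : ℂ)) (nhds 0) (nhds 0) := by
          have := Complex.continuous_ofReal.tendsto 0
          simpa using this
        filter_upwards [hcont.eventually hcon] with r hr
        have e1 := hfp r 0
        have e2 := hfp 0 0
        simp only [Complex.ofReal_zero, zero_mul, Complex.exp_zero, mul_one] at e1 e2
        rw [← e1, hr, e2]
        rw [Gam, Gam, tsum_eq_single 0, tsum_eq_single 0]
        · simp
        · intro n hn; simp [hn]
        · intro n hn; simp [hn]
    have h2 := hH0 2
    have g0 : ∀ n, g n 0 = if n = 1 then 1 else 0 := S.hg0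
    have g1 : g 1 Real.pi = 1 := by
      have hd0 : ∀ θ, d 0 θ = 0 := fun θ => by rw [S.hs.d_eq S.ha0]; simp
      have hd1 : ∀ θ, d 1 θ = 0 := fun θ => by rw [S.hs.d_eq S.ha0]; simp [hd0]
      have := is_const_of_deriv_eq_zero (f := g 1) (fun x => (S.hs.1 1 x).differentiableAt)
        (fun x => by rw [(S.hs.1 1 x).deriv, hd1]) Real.pi 0
      rw [this, g0]; simp
    simp only [hH] at h2
    rw [Finset.Nat.sum_antidiagonal_succ, Finset.Nat.sum_antidiagonal_succ] at h2
    simp [g0, g1] at h2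
  · have hδ := S.hδ
    obtain ⟨η, hη, hh⟩ := Metric.eventually_nhds_iff.1 hf.eventually_analyticAt
    have hball : Metric.ball (0 : ℂ) (min η (min δ (1 / (2 * (4 * B))))) ∈ nhds (0 : ℂ) :=
      Metric.ball_mem_nhds _ (by positivity)
    filter_upwards [hball] with p hp
    by_cases hp0 : p = 0
    · rw [hp0, hY0, map_zero]
    have hp' : ‖p‖ < min η (min δ (1 / (2 * (4 * B)))) := by simpa using hp
    have hp1 : ‖p‖ < η := hp'.trans_le (min_le_left _ _)
    have hp2 : ‖p‖ < δ := hp'.trans_le ((min_le_right _ _).trans (min_le_left _ _))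
    have hp3 : ‖p‖ < 1 / (2 * (4 * B)) := hp'.trans_le ((min_le_right _ _).trans (min_le_right _ _))
    have hfd := (hh (y := p) (by simpa using hp1)).differentiableAt.hasFDerivAt
    set r := ‖p‖ with hr
    set θ := p.arg with hθ
    have hpe : p = r * Complex.exp (θ * Complex.I) := (Complex.norm_mul_exp_arg_mul_I p).symm
    have hrpos : 0 < r := norm_pos_iff.2 hp0
    have hθ' : |θ| < 13 / 2 := (Complex.abs_arg_le_pi p).trans_lt (by linarith [two_pi_lt, Real.pi_pos])
    obtain ⟨D', hD1, hD2⟩ := gam_hasFDerivAt hP' (B := 4 * B) (L := 13 / 2) (by positivity) hHb hDb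
      (r := r) (θ := θ) (by rw [abs_of_pos hrpos]; exact hp3) hθ'
    have hser := S.hser r θ hrpos.ne' (by rw [abs_of_pos hrpos]; exact hp2)
    rw [← hpe] at hser
    have hz := hD2 _ hser.1 hser.2
    set w := Y p / p with hw
    have hYw : Y p = p * w := by rw [hw]; field_simp
    let q1 : ℝ → ℝ := fun t => r + t * (r * w.re)
    let q2 : ℝ → ℝ := fun t => θ + t * w.im
    have hq1 : HasDerivAt q1 (r * w.re) 0 := by
      exact (((hasDerivAt_id (0 : ℝ)).mul_const (r * w.re)).const_add r).congr_deriv (by simp)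
    have hq2 : HasDerivAt q2 (w.im) 0 := by
      exact (((hasDerivAt_id (0 : ℝ)).mul_const (w.im)).const_add θ).congr_deriv (by simp)
    have hq10 : q1 0 = r := by simp [q1]
    have hq20 : q2 0 = θ := by simp [q2]
    have hz1 : HasDerivAt (fun t => (q1 t : ℂ) * Complex.exp (q2 t * Complex.I)) (Y p) 0 := by
      refine (hq1.ofReal_comp.mul ((hq2.ofReal_comp.mul_const Complex.I).cexp)).congr_deriv ?_
      rw [hq10, hq20, hYw]
      have hwe : w = w.re + w.im * Complex.I := (Complex.re_add_im w).symm
      rw [hpe]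
      conv_rhs => rw [hwe]
      push_cast
      ring
    have hz0 : (q1 0 : ℂ) * Complex.exp (q2 0 * Complex.I) = p := by rw [hq10, hq20, ← hpe]
    rw [← hz0] at hfd
    have c1 := hfd.comp_hasDerivAt (0 : ℝ) hz1
    have hD1' : HasFDerivAt (fun q : ℝ × ℝ => Gam H q.1 q.2) D' (q1 0, q2 0) := by
      rw [hq10, hq20]; exact hD1
    have c2 := HasFDerivAt.comp_hasDerivAt (x := (0 : ℝ)) (f := fun t => (q1 t, q2 t)) hD1' (hq1.prodMk hq2)
    rw [hz] at c2
    have e : ((fun z => (FF c z).re) ∘ fun t => (q1 t : ℂ) * Complex.exp (q2 t * Complex.I)) =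
        (fun q : ℝ × ℝ => Gam H q.1 q.2) ∘ fun t => (q1 t, q2 t) := by
      funext t
      simp only [Function.comp]
      exact hfp _ _
    rw [e] at c1
    have := c1.unique c2
    rw [hz0] at this
    exact this

theorem core (Y : ℂ → ℂ) (hY : AnalyticAt ℝ Y 0) (hY0 : Y 0 = 0)
    (hd : ∀ z, fderiv ℝ Y 0 z = Complex.I * z)
    (horb : ∀ η > (0 : ℝ), ∃ c : ℝ → ℂ, (∀ t, HasDerivAt c (Y (c t)) t) ∧ ∀ t, c t ≠ 0 ∧ ‖c t‖ < η) :
    (∃ δ > (0 : ℝ), ∀ c : ℝ → ℂ, (∀ t, HasDerivAt c (Y (c t)) t) → (∀ t, c t ≠ 0 ∧ ‖c t‖ < δ) →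
      ∃ T > (0 : ℝ), ∀ t, c (t + T) = c t) ∧
    ∃ f : ℂ → ℝ, AnalyticAt ℝ f 0 ∧ ¬ (f =ᶠ[nhds (0 : ℂ)] fun _ => f 0) ∧
      ∀ᶠ p in nhds (0 : ℂ), fderiv ℝ f p (Y p) = 0 := by
  obtain ⟨F, a, g, d, B, δ, S⟩ := setup Y hY hY0 hd
  have h := per0 S horb
  exact ⟨⟨δ, S.hδ, fun c hc hc' => center S h c hc hc'⟩, integral S hY0 h⟩

end PL


namespace PL

theorem final (X : ℝ × ℝ → ℝ × ℝ) (hX : AnalyticAt ℝ X 0) (hX0 : X 0 = 0)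
    (htr : LinearMap.trace ℝ (ℝ × ℝ)
      ((fderiv ℝ X 0 : ℝ × ℝ →L[ℝ] ℝ × ℝ) : ℝ × ℝ →ₗ[ℝ] ℝ × ℝ) = 0)
    (hdet : LinearMap.det
      ((fderiv ℝ X 0 : ℝ × ℝ →L[ℝ] ℝ × ℝ) : ℝ × ℝ →ₗ[ℝ] ℝ × ℝ) = 1)
    (γ : ℕ → ℝ → ℝ × ℝ)
    (hsol : ∀ ν t, HasDerivAt (γ ν) (X (γ ν t)) t)
    (hin : ∀ ν t, γ ν t ≠ 0)
    (hHaus : ∀ δ > (0 : ℝ), ∃ N : ℕ, ∀ ν ≥ N, ∀ t, ‖γ ν t‖ < δ) :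
    (∃ W ∈ nhds (0 : ℝ × ℝ), ∀ c : ℝ → ℝ × ℝ,
      (∀ t, HasDerivAt c (X (c t)) t) → (∀ t, c t ∈ W \ {0}) →
      ∃ T > (0 : ℝ), ∀ t, c (t + T) = c t) ∧
    ∃ f : ℝ × ℝ → ℝ, AnalyticAt ℝ f 0 ∧
      ¬ (f =ᶠ[nhds (0 : ℝ × ℝ)] fun _ => f 0) ∧
      ∀ᶠ p in nhds (0 : ℝ × ℝ), fderiv ℝ f p (X p) = 0 := by
  set L := fderiv ℝ X 0 with hL
  set a := (L (1, 0)).1 with ha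
  set c := (L (1, 0)).2 with hc
  set b := (L (0, 1)).1 with hb
  set d := (L (0, 1)).2 with hd
  have hLv : ∀ u v : ℝ, L (u, v) = (u * a + v * b, u * c + v * d) := by
    intro u v
    have : ((u, v) : ℝ × ℝ) = u • (1, 0) + v • (0, 1) := by simp
    rw [this, map_add, map_smul, map_smul]
    ext <;> simp [a, b, c, d]
  have h1 : a + d = 0 := by
    rw [LinearMap.trace_eq_matrix_trace ℝ (Module.Basis.finTwoProd ℝ), Matrix.trace_fin_two] at htr
    simpa [LinearMap.toMatrix_apply, a, d] using htr
  have h2 : a * d - b * c = 1 := by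
    rw [← LinearMap.det_toMatrix (Module.Basis.finTwoProd ℝ), Matrix.det_fin_two] at hdet
    simpa [LinearMap.toMatrix_apply, a, b, c, d] using hdet
  have hc0 : c ≠ 0 := by
    intro h
    rw [h, mul_zero, sub_zero, show d = -a by linarith] at h2
    nlinarith [sq_nonneg a]
  let e0 : (ℝ × ℝ) ≃ₗ[ℝ] ℂ :=
    { toFun := fun p => ⟨p.1 - a * p.2 / c, p.2 / c⟩
      invFun := fun z => (z.re + a * z.im, c * z.im)
      map_add' := fun p q => by apply Complex.ext <;> simp <;> ring
      map_smul' := fun s p => by apply Complex.ext <;> simp <;> ring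
      left_inv := fun p => by ext <;> simp <;> field_simp <;> ring
      right_inv := fun z => by apply Complex.ext <;> simp <;> field_simp <;> ring }
  let e : (ℝ × ℝ) ≃L[ℝ] ℂ := e0.toContinuousLinearEquiv
  have he : ∀ p, e p = ⟨p.1 - a * p.2 / c, p.2 / c⟩ := fun p => rfl
  have heL : ∀ p, e (L p) = Complex.I * e p := by
    rintro ⟨u, v⟩
    rw [hLv, he, he]
    have hd' : d = -a := by linarith
    have hb' : b = -(1 + a * a) / c := by
      rw [eq_div_iff hc0]; rw [hd'] at h2; linarith
    apply Complex.ext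
    · simp only [Complex.mul_re, Complex.I_re, Complex.I_im]
      rw [hd', hb']; field_simp; ring
    · simp only [Complex.mul_im, Complex.I_re, Complex.I_im]
      rw [hd']; field_simp; ring
  let Y : ℂ → ℂ := fun z => e (X (e.symm z))
  have hYe : ∀ p, Y (e p) = e (X p) := fun p => by simp [Y]
  have hes0 : e.symm 0 = 0 := map_zero _
  have hYan : AnalyticAt ℝ Y 0 := by
    have h1 : AnalyticAt ℝ (fun z => e.symm z) (0 : ℂ) := (e.symm : ℂ →L[ℝ] ℝ × ℝ).analyticAt 0
    have h2 : AnalyticAt ℝ (fun z => X (e.symm z)) (0 : ℂ) :=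
      AnalyticAt.comp' (by rw [hes0]; exact hX) h1
    exact AnalyticAt.comp' ((e : ℝ × ℝ →L[ℝ] ℂ).analyticAt _) h2
  have hY0 : Y 0 = 0 := by simp [Y, hX0]
  have hYd : ∀ z, fderiv ℝ Y 0 z = Complex.I * z := by
    have hXd : HasFDerivAt X L (e.symm 0) := by
      rw [hes0]; exact hX.differentiableAt.hasFDerivAt
    have h2 := (e : ℝ × ℝ →L[ℝ] ℂ).hasFDerivAt.comp (0 : ℂ)
      (hXd.comp (0 : ℂ) (e.symm : ℂ →L[ℝ] ℝ × ℝ).hasFDerivAt)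
    have h3 : HasFDerivAt Y _ 0 := h2
    intro z
    rw [h3.fderiv]
    have := heL (e.symm z)
    rw [e.apply_symm_apply] at this
    exact this
  have hsolY : ∀ c : ℝ → ℝ × ℝ, (∀ t, HasDerivAt c (X (c t)) t) →
      ∀ t, HasDerivAt (fun t => e (c t)) (Y (e (c t))) t := by
    intro c hc t
    rw [hYe]
    exact (e : ℝ × ℝ →L[ℝ] ℂ).hasFDerivAt.comp_hasDerivAt t (hc t)
  have htend : Filter.Tendsto e (nhds 0) (nhds 0) := by
    have := e.continuous.tendsto 0
    rwa [map_zero] at this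
  have horb : ∀ η > (0 : ℝ), ∃ c : ℝ → ℂ, (∀ t, HasDerivAt c (Y (c t)) t) ∧
      ∀ t, c t ≠ 0 ∧ ‖c t‖ < η := by
    intro η hη
    have := htend (Metric.ball_mem_nhds (0 : ℂ) hη)
    obtain ⟨δ, hδ, hδ'⟩ := Metric.mem_nhds_iff.1 this
    obtain ⟨N, hN⟩ := hHaus δ hδ
    refine ⟨fun t => e (γ N t), hsolY _ (hsol N), fun t => ⟨?_, ?_⟩⟩
    · simpa using hin N t
    · have : γ N t ∈ Metric.ball (0 : ℝ × ℝ) δ := by simpa using hN N le_rfl t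
      have := hδ' this
      simpa using this
  obtain ⟨⟨δ, hδ, hcen⟩, f, hf, hfn, hfi⟩ := core Y hYan hY0 hYd horb
  refine ⟨⟨e ⁻¹' Metric.ball 0 δ, htend (Metric.ball_mem_nhds (0 : ℂ) hδ), ?_⟩, ?_⟩
  · intro c hc hcW
    obtain ⟨T, hT, hper⟩ := hcen (fun t => e (c t)) (hsolY c hc) (fun t => by
      obtain ⟨u, v⟩ := hcW t
      exact ⟨by simpa using v, by simpa using u⟩)
    exact ⟨T, hT, fun t => e.injective (hper t)⟩
  · have he00 : e 0 = 0 := map_zero e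
    refine ⟨fun p => f (e p), ?_, ?_, ?_⟩
    · exact AnalyticAt.comp' (by rw [he00]; exact hf) ((e : ℝ × ℝ →L[ℝ] ℂ).analyticAt 0)
    · intro hcon
      apply hfn
      have hts : Filter.Tendsto e.symm (nhds 0) (nhds 0) := by
        have := e.symm.continuous.tendsto 0
        rwa [map_zero] at this
      filter_upwards [hts.eventually hcon] with z hz
      simpa using hz
    · have hfd : ∀ᶠ z in nhds (0 : ℂ), DifferentiableAt ℝ f z :=
        hf.eventually_analyticAt.mono fun z hz => hz.differentiableAt
      filter_upwards [htend.eventually (hfi.and hfd)] with p hp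
      have h3 : HasFDerivAt (fun p => f (e p)) _ p :=
        hp.2.hasFDerivAt.comp p (e : ℝ × ℝ →L[ℝ] ℂ).hasFDerivAt
      rw [h3.fderiv]
      have := hp.1
      rw [hYe] at this
      exact this

end PL



open Filter

/-- Theorem B (bounded order): let `X` be a real analytic vector field near
`0 ∈ ℝ²` with `X(0) = 0` and `DX(0)` with eigenvalues `±i`. Suppose there is a
transverse segment `Σ = φ((0,ε))` through the origin, a bound `k`, and a
sequence of orbits `γ_ν ⊆ U \ {0}` converging to `0` in the Hausdorff sense,
each meeting `Σ` in at most `k` points. Then `0` is a center for `X` and `X`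
admits a nonconstant real analytic first integral near `0`. -/
theorem center_of_bounded_order_orbits
    (U : Set (ℝ × ℝ)) (hU : U ∈ nhds (0 : ℝ × ℝ))
    (X : ℝ × ℝ → ℝ × ℝ) (hX : AnalyticAt ℝ X 0) (hX0 : X 0 = 0)
    (htr : LinearMap.trace ℝ (ℝ × ℝ)
      ((fderiv ℝ X 0 : ℝ × ℝ →L[ℝ] ℝ × ℝ) : ℝ × ℝ →ₗ[ℝ] ℝ × ℝ) = 0)
    (hdet : LinearMap.det
      ((fderiv ℝ X 0 : ℝ × ℝ →L[ℝ] ℝ × ℝ) : ℝ × ℝ →ₗ[ℝ] ℝ × ℝ) = 1)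
    -- the transverse segment
    (ε : ℝ) (hε : 0 < ε) (φ : ℝ → ℝ × ℝ) (φ' : ℝ → ℝ × ℝ)
    (hφc : ContinuousOn φ (Set.Ico 0 ε)) (hφinj : Set.InjOn φ (Set.Ico 0 ε))
    (hφ0 : φ 0 = 0)
    (hφder : ∀ t ∈ Set.Ioo 0 ε, HasDerivAt φ (φ' t) t)
    (hφimm : ∀ t ∈ Set.Ioo 0 ε, φ' t ≠ 0)
    (htrans : ∀ t ∈ Set.Ioo 0 ε, LinearIndependent ℝ ![φ' t, X (φ t)])
    -- the orbits of bounded order accumulating at the origin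
    (k : ℕ) (hk : 0 < k) (γ : ℕ → ℝ → ℝ × ℝ)
    (hsol : ∀ ν t, HasDerivAt (γ ν) (X (γ ν t)) t)
    (hin : ∀ ν t, γ ν t ∈ U \ {0})
    (horder : ∀ ν, (Set.range (γ ν) ∩ (φ '' Set.Ioo 0 ε)).Finite ∧
      (Set.range (γ ν) ∩ (φ '' Set.Ioo 0 ε)).ncard ≤ k)
    (hHaus : ∀ δ > (0 : ℝ), ∃ N : ℕ, ∀ ν ≥ N, ∀ t, ‖γ ν t‖ < δ) :
    (∃ W ∈ nhds (0 : ℝ × ℝ), ∀ c : ℝ → ℝ × ℝ,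
      (∀ t, HasDerivAt c (X (c t)) t) → (∀ t, c t ∈ W \ {0}) →
      ∃ T > (0 : ℝ), ∀ t, c (t + T) = c t) ∧
    ∃ f : ℝ × ℝ → ℝ, AnalyticAt ℝ f 0 ∧
      ¬ (f =ᶠ[nhds (0 : ℝ × ℝ)] fun _ => f 0) ∧
      ∀ᶠ p in nhds (0 : ℝ × ℝ), fderiv ℝ f p (X p) = 0 := by
  exact PL.final X hX hX0 htr hdet γ hsol (fun ν t => (hin ν t).2) hHaus
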